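/- arXiv:1112.6014 — 5 statements merged into one kernel-verified Lean document; each statement's English description precedes it below -/
import Mathlib

section
/- For every integer n ≥ 1, M_n(q,t) = M_{n-1}(q,qt) + Σ_{k=2}^{n} [M_{k-1}(q,t) + (q^{k-1}t − 1)M_{k-2}(q,t)]·M_{n-k}(q,q^{k}t), as an identity in ℤ[q,t], where M_m(q,u) denotes the polynomial M_m(q,t) with t replaced by u. -/
open Finset MvPolynomial

/-- `σ` avoids the pattern 321. -/
def Avoids321 {n : ℕ} (σ : Equiv.Perm (Fin n)) : Prop :=
  ¬ ∃ i j k : Fin n, i < j ∧ j < k ∧ σ k < σ j ∧ σ j < σ i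

instance {n : ℕ} : DecidablePred (Avoids321 (n := n)) := fun σ => by
  unfold Avoids321; infer_instance

/-- The set of 321-avoiding permutations of `{1,…,n}` (modelled on `Fin n`). -/
def Av (n : ℕ) : Finset (Equiv.Perm (Fin n)) := univ.filter Avoids321

/-- The number of inversions of a permutation. -/
def invPerm {n : ℕ} (σ : Equiv.Perm (Fin n)) : ℕ :=
  (univ.filter (fun p : Fin n × Fin n => p.1 < p.2 ∧ σ p.2 < σ p.1)).card

/-- Position `i` is a left-right maximum of `σ`. -/
def IsLRMax {n : ℕ} (σ : Equiv.Perm (Fin n)) (i : Fin n) : Prop :=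
  ∀ j, j ≤ i → σ j ≤ σ i

instance {n : ℕ} (σ : Equiv.Perm (Fin n)) : DecidablePred (IsLRMax σ) := fun i => by
  unfold IsLRMax; infer_instance

/-- The number of left-right maxima of `σ`. -/
def lrm {n : ℕ} (σ : Equiv.Perm (Fin n)) : ℕ := (univ.filter (IsLRMax σ)).card

/-- The number of fixed points of `σ`. -/
def fixPerm {n : ℕ} (σ : Equiv.Perm (Fin n)) : ℕ := (univ.filter (fun i => σ i = i)).card

/-- The number of excedances of `σ`. -/
def excPerm {n : ℕ} (σ : Equiv.Perm (Fin n)) : ℕ := (univ.filter (fun i => i < σ i)).card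

/-- The descent set of `σ`: `i` is in it iff `σ` descends from position `i+1` to `i+2`
(0-based index `i` corresponds to the 1-based descent position `i+1`). -/
def DesPerm {n : ℕ} (σ : Equiv.Perm (Fin n)) : Finset (Fin n) :=
  univ.filter (fun i => ∃ h : i.val + 1 < n, σ ⟨i.val + 1, h⟩ < σ i)

/-- The number of descents of `σ`. -/
def desPerm {n : ℕ} (σ : Equiv.Perm (Fin n)) : ℕ := (DesPerm σ).card

/-- The major index of `σ` (descents at 1-based positions). -/
def majPerm {n : ℕ} (σ : Equiv.Perm (Fin n)) : ℕ := ∑ i ∈ DesPerm σ, (i.val + 1)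

/-- Number of `true` letters among the first `i` letters of the word `P`. -/
def UpCt {m : ℕ} (P : Fin m → Bool) (i : ℕ) : ℕ :=
  (univ.filter (fun j : Fin m => j.val < i ∧ P j = true)).card

/-- Number of `false` letters among the first `i` letters of the word `P`. -/
def DownCt {m : ℕ} (P : Fin m → Bool) (i : ℕ) : ℕ :=
  (univ.filter (fun j : Fin m => j.val < i ∧ P j = false)).card

/-- A word (with `true` = U, `false` = D) is a Dyck word: every prefix has at least as
many U's as D's, and the total numbers of U's and D's agree. -/
def IsDyck {m : ℕ} (P : Fin m → Bool) : Prop :=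
  (∀ i, i ≤ m → DownCt P i ≤ UpCt P i) ∧ UpCt P m = DownCt P m

instance {m : ℕ} : DecidablePred (IsDyck (m := m)) := fun P => by
  unfold IsDyck; infer_instance

/-- The Dyck paths of semilength `n`, as words of length `2n`. -/
def DyckSet (n : ℕ) : Finset (Fin (2 * n) → Bool) := univ.filter IsDyck

/-- Valleys (descents of the word, i.e. factors `DU`), recorded by the 0-based
index of the `D` step. -/
def Valleys {m : ℕ} (P : Fin m → Bool) : Finset (Fin m) :=
  univ.filter (fun j => P j = false ∧ ∃ h : j.val + 1 < m, P ⟨j.val + 1, h⟩ = true)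

/-- `des` of a path: the number of valleys. -/
def desPath {m : ℕ} (P : Fin m → Bool) : ℕ := (Valleys P).card

/-- `maj` of a path: the sum of the (1-based) positions of the descents. -/
def majPath {m : ℕ} (P : Fin m → Bool) : ℕ := ∑ j ∈ Valleys P, (j.val + 1)

/-- `α(P) = Σ_{i ∈ Des P} |p_i(P)|_U`. -/
def alphaPath {m : ℕ} (P : Fin m → Bool) : ℕ := ∑ j ∈ Valleys P, UpCt P (j.val + 1)

/-- `β(P) = Σ_{i ∈ Des P} |p_i(P)|_D`. -/
def betaPath {m : ℕ} (P : Fin m → Bool) : ℕ := ∑ j ∈ Valleys P, DownCt P (j.val + 1)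

/-- Peaks (factors `UD`), recorded by the 0-based index of the `U` step. -/
def Peaks {m : ℕ} (P : Fin m → Bool) : Finset (Fin m) :=
  univ.filter (fun j => P j = true ∧ ∃ h : j.val + 1 < m, P ⟨j.val + 1, h⟩ = false)

/-- The number of peaks of `P`. -/
def npea {m : ℕ} (P : Fin m → Bool) : ℕ := (Peaks P).card

/-- `spea P = Σ_p (HT(p) - 1)` over peaks `p`, where `HT` is the height of a peak. -/
def spea {m : ℕ} (P : Fin m → Bool) : ℕ :=
  ∑ j ∈ Peaks P, (UpCt P (j.val + 1) - DownCt P (j.val + 1) - 1)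

/-- The height of the path after `i` steps. -/
def htAt {m : ℕ} (P : Fin m → Bool) (i : ℕ) : ℤ := (UpCt P i : ℤ) - (DownCt P i : ℤ)

/-- The start of the tunnel of the valley whose lowest lattice point comes after
`k` steps: the largest `m < k` at which the path has the same height. -/
def tunnelStart {m : ℕ} (P : Fin m → Bool) (k : ℕ) : ℕ :=
  ((Finset.range k).filter (fun j => htAt P j = htAt P k)).sup id

/-- `stun P`: the sum over all valleys of the semilengths of their tunnels. -/
def stun {m : ℕ} (P : Fin m → Bool) : ℕ :=
  ∑ j ∈ Valleys P, (j.val + 1 - tunnelStart P (j.val + 1)) / 2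

/-- A parallelogram polyomino: a pair `(U,V)` of `N/E`-paths (`true` = N, `false` = E)
of the same length, with the same endpoints, such that `U` stays strictly above `V`
except at the endpoints (i.e. every proper nonempty prefix of `U` contains strictly
more `N`-steps than the corresponding prefix of `V`).  As noted by Fürlinger and
Hofbauer, the lower path begins with an `E`-step and the upper path ends with an
`E`-step; this is automatic for `m ≥ 2` and fixes the convention in the degenerate
case `m = 1`. -/
def IsParaPoly {m : ℕ} (U V : Fin m → Bool) : Prop :=
  UpCt U m = UpCt V m ∧ (∀ i, i < m → 1 ≤ i → UpCt V i < UpCt U i) ∧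
    UpCt V 1 = 0 ∧ UpCt U m = UpCt U (m - 1)

instance {m : ℕ} (U V : Fin m → Bool) : Decidable (IsParaPoly U V) := by
  unfold IsParaPoly; infer_instance

/-- The parallelogram polyominoes of size `n`. -/
def ParaSet (n : ℕ) : Finset ((Fin n → Bool) × (Fin n → Bool)) :=
  univ.filter (fun UV => IsParaPoly UV.1 UV.2)

/-- A shortened polyomino: a pair `(P,Q)` of `N/E`-paths of the same length with the
same endpoints such that `P` stays weakly above `Q` and the two paths share no
`N`-steps (an `N`-step is shared exactly when it occurs at the same index with equal
prefix `N`-counts). -/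
def IsShortPoly {m : ℕ} (P Q : Fin m → Bool) : Prop :=
  UpCt P m = UpCt Q m ∧ (∀ i, i ≤ m → UpCt Q i ≤ UpCt P i) ∧
    ∀ j : Fin m, UpCt P j.val = UpCt Q j.val → ¬(P j = true ∧ Q j = true)

instance {m : ℕ} (P Q : Fin m → Bool) : Decidable (IsShortPoly P Q) := by
  unfold IsShortPoly; infer_instance

/-- The shortened polyominoes of size `n`. -/
def ShortSet (n : ℕ) : Finset ((Fin n → Bool) × (Fin n → Bool)) :=
  univ.filter (fun PQ => IsShortPoly PQ.1 PQ.2)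

/-- The sum, over the `E`-steps of a path, of their heights (`N`-count before the step). -/
def eSum {m : ℕ} (W : Fin m → Bool) : ℕ :=
  ∑ j ∈ univ.filter (fun j : Fin m => W j = false), UpCt W j.val

/-- The area between the upper path `U` and the lower path `V`. -/
def areaPoly {m : ℕ} (U V : Fin m → Bool) : ℕ := eSum U - eSum V

/-- The number of columns spanned: the number of `E`-steps of the path. -/
def colPoly {m : ℕ} (W : Fin m → Bool) : ℕ := (univ.filter (fun j : Fin m => W j = false)).card

/-- `I_n(q,t) = Σ_{σ ∈ Av_n(321)} q^{inv σ} t^{lrm σ}`, with `q = X 0`, `t = X 1`. -/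
noncomputable def IPoly (n : ℕ) : MvPolynomial (Fin 2) ℤ :=
  ∑ σ ∈ Av n, X 0 ^ invPerm σ * X 1 ^ lrm σ

/-- `M_n(q,t) = Σ_{σ ∈ Av_n(321)} q^{maj σ} t^{des σ}`, with `q = X 0`, `t = X 1`. -/
noncomputable def MPoly (n : ℕ) : MvPolynomial (Fin 2) ℤ :=
  ∑ σ ∈ Av n, X 0 ^ majPerm σ * X 1 ^ desPerm σ

/-- `I_n(q,t,x) = Σ_{σ ∈ Av_n(321)} q^{inv σ} t^{lrm σ} x^{fix σ}`,
with `q = X 0`, `t = X 1`, `x = X 2`. -/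
noncomputable def IPoly3 (n : ℕ) : MvPolynomial (Fin 3) ℤ :=
  ∑ σ ∈ Av n, X 0 ^ invPerm σ * X 1 ^ lrm σ * X 2 ^ fixPerm σ

/-- `C_n(a,b;t) = Σ_{P ∈ D_n} a^{α(P)} b^{β(P)} t^{des P}`,
with `a = X 0`, `b = X 1`, `t = X 2`. -/
noncomputable def CPoly (n : ℕ) : MvPolynomial (Fin 3) ℤ :=
  ∑ P ∈ DyckSet n, X 0 ^ alphaPath P * X 1 ^ betaPath P * X 2 ^ desPath P

/-- `P_n(q,t) = Σ_{(U,V) ∈ 𝒫_n} q^{area(U,V)} t^{col(U,V)}`, with `q = X 0`, `t = X 1`. -/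
noncomputable def PPoly (n : ℕ) : MvPolynomial (Fin 2) ℤ :=
  ∑ UV ∈ ParaSet n, X 0 ^ areaPoly UV.1 UV.2 * X 1 ^ colPoly UV.1

/-- `I_n(-1,t) = Σ_{σ ∈ Av_n(321)} (-1)^{inv σ} t^{lrm σ} ∈ ℤ[t]`. -/
noncomputable def ISign (n : ℕ) : Polynomial ℤ :=
  ∑ σ ∈ Av n, Polynomial.C ((-1 : ℤ) ^ invPerm σ) * Polynomial.X ^ lrm σ

/-- Substitution `t ↦ q^k t` for polynomials in `q = X 0`, `t = X 1`. -/
noncomputable def subT (k : ℕ) (f : MvPolynomial (Fin 2) ℤ) : MvPolynomial (Fin 2) ℤ :=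
  bind₁ (fun i : Fin 2 => if i = 0 then X 0 else X 0 ^ k * X 1) f

/-- Substitution `t ↦ u` (third variable) for polynomials in `a = X 0`, `b = X 1`, `t = X 2`. -/
noncomputable def subT3 (u : MvPolynomial (Fin 3) ℤ) (f : MvPolynomial (Fin 3) ℤ) :
    MvPolynomial (Fin 3) ℤ :=
  bind₁ (fun i : Fin 3 => if i = 2 then u else X i) f

/-- Substitution `x ↦ 1` (third variable) for polynomials in `q = X 0`, `t = X 1`, `x = X 2`. -/
noncomputable def subX1 (f : MvPolynomial (Fin 3) ℤ) : MvPolynomial (Fin 3) ℤ :=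
  bind₁ (fun i : Fin 3 => if i = 2 then 1 else X i) f

/-- `val σ`: indicator vector of left-right maximum values (`val σ i = 1` iff the value `i`
occurs at a left-right maximum position of `σ`). -/
def valVec {n : ℕ} (σ : Equiv.Perm (Fin n)) (i : Fin n) : ℕ :=
  if ∃ j, IsLRMax σ j ∧ σ j = i then 1 else 0

/-- `pos σ`: indicator vector of left-right maximum positions. -/
def posVec {n : ℕ} (σ : Equiv.Perm (Fin n)) (i : Fin n) : ℕ :=
  if IsLRMax σ i then 1 else 0

/-- The permutation of `Fin (n + 1)` with first value `v` whose remaining values are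
order-isomorphic to `σ`. -/
def prependPerm {n : ℕ} (σ : Equiv.Perm (Fin n)) (v : Fin (n + 1)) : Equiv.Perm (Fin (n + 1)) :=
  (finSuccEquiv n).trans ((Equiv.optionCongr σ).trans (finSuccEquiv' v).symm)

@[simp] theorem prependPerm_zero {n : ℕ} (σ : Equiv.Perm (Fin n)) (v : Fin (n + 1)) :
    prependPerm σ v 0 = v := by
  simp [prependPerm]

@[simp] theorem prependPerm_succ {n : ℕ} (σ : Equiv.Perm (Fin n)) (v : Fin (n + 1)) (i : Fin n) :
    prependPerm σ v i.succ = v.succAbove (σ i) := by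
  simp [prependPerm]

theorem prependPerm_bijective (n : ℕ) :
    Function.Bijective
      (fun p : Equiv.Perm (Fin n) × Fin (n + 1) => prependPerm p.1 p.2) := by
  rw [Fintype.bijective_iff_injective_and_card]
  constructor
  · rintro ⟨σ, v⟩ ⟨τ, w⟩ h
    have h0 : v = w := by simpa using congrArg (fun ρ => ρ 0) h
    subst h0
    refine Prod.ext (Equiv.ext fun i => ?_) rfl
    simpa using congrArg (fun ρ => ρ i.succ) h
  · simp [Fintype.card_perm, Nat.factorial_succ, mul_comm]

/-- `v ≤ n` lies weakly below the top value of every inversion of `σ`. -/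
def BelowInversions {n : ℕ} (σ : Equiv.Perm (Fin n)) (v : ℕ) : Prop :=
  v ≤ n ∧ ∀ i j : Fin n, i < j → σ j < σ i → v ≤ (σ i).val

instance {n : ℕ} (σ : Equiv.Perm (Fin n)) : DecidablePred (BelowInversions σ) := fun v => by
  unfold BelowInversions; infer_instance

/-- The smallest value of `σ` that is the top of an inversion, or `n` if there is none. -/
def minInvTop {n : ℕ} (σ : Equiv.Perm (Fin n)) : ℕ :=
  ((range (n + 1)).filter (BelowInversions σ)).sup id

theorem le_minInvTop_iff {n : ℕ} (σ : Equiv.Perm (Fin n)) (v : ℕ) :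
    v ≤ minInvTop σ ↔ BelowInversions σ v := by
  constructor
  · intro h
    have hne : ((range (n + 1)).filter (BelowInversions σ)).Nonempty :=
      ⟨0, by simp [BelowInversions]⟩
    obtain ⟨w, hw, hw'⟩ := Finset.exists_mem_eq_sup _ hne (id : ℕ → ℕ)
    have hB : BelowInversions σ w := (mem_filter.1 hw).2
    have hvw : v ≤ w := by
      unfold minInvTop at h
      rw [hw'] at h
      exact h
    exact ⟨hvw.trans hB.1, fun i j hij hs => hvw.trans (hB.2 i j hij hs)⟩
  · intro h
    exact Finset.le_sup (f := (id : ℕ → ℕ))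
      (mem_filter.2 ⟨mem_range.2 (Nat.lt_succ_of_le h.1), h⟩)

theorem minInvTop_le {n : ℕ} (σ : Equiv.Perm (Fin n)) : minInvTop σ ≤ n :=
  ((le_minInvTop_iff σ _).1 le_rfl).1

/-- `σ` fixes the first letter (vacuously true for the empty permutation). -/
def FixesFirst {n : ℕ} (σ : Equiv.Perm (Fin n)) : Prop := ∀ h : 0 < n, σ ⟨0, h⟩ = ⟨0, h⟩

instance {n : ℕ} (σ : Equiv.Perm (Fin n)) : Decidable (FixesFirst σ) := by
  unfold FixesFirst; infer_instance

theorem fixesFirst_prependPerm {n : ℕ} (σ : Equiv.Perm (Fin n)) (v : Fin (n + 1)) :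
    FixesFirst (prependPerm σ v) ↔ v = 0 := by
  constructor
  · intro h
    simpa using h (Nat.succ_pos n)
  · rintro rfl _
    exact prependPerm_zero σ 0

theorem succAbove_lt_iff_val {n : ℕ} (v : Fin (n + 1)) (x : Fin n) :
    v.succAbove x < v ↔ x.val < v.val := by
  rw [Fin.succAbove_lt_iff_castSucc_lt, Fin.lt_def]
  rfl

theorem avoids321_prependPerm {n : ℕ} (σ : Equiv.Perm (Fin n)) (v : Fin (n + 1)) :
    Avoids321 (prependPerm σ v) ↔ Avoids321 σ ∧ v.val ≤ minInvTop σ := by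
  rw [le_minInvTop_iff]
  constructor
  · intro h
    refine ⟨?_, Nat.le_of_lt_succ v.isLt, ?_⟩
    · rintro ⟨i, j, k, hij, hjk, h1, h2⟩
      exact h ⟨i.succ, j.succ, k.succ, by simpa using hij, by simpa using hjk,
        by simpa using h1, by simpa using h2⟩
    · intro i j hij hs
      by_contra hlt
      exact h ⟨0, i.succ, j.succ, Fin.succ_pos i, by simpa using hij, by simpa using hs,
        by simpa [succAbove_lt_iff_val] using hlt⟩
  · rintro ⟨hσ, -, hv⟩ ⟨i, j, k, hij, hjk, h1, h2⟩
    cases k using Fin.cases with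
    | zero => exact absurd hjk (Fin.not_lt_zero j)
    | succ k =>
    cases j using Fin.cases with
    | zero => exact absurd hij (Fin.not_lt_zero i)
    | succ j =>
    simp only [Fin.succ_lt_succ_iff] at hjk
    simp only [prependPerm_succ, Fin.succAbove_lt_succAbove_iff] at h1
    cases i using Fin.cases with
    | zero =>
      simp only [prependPerm_zero, prependPerm_succ, succAbove_lt_iff_val] at h2
      exact absurd (hv j k hjk h1) (not_le.2 h2)
    | succ i =>
      simp only [prependPerm_succ, Fin.succAbove_lt_succAbove_iff, Fin.succ_lt_succ_iff] at h2 hij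
      exact hσ ⟨i, j, k, hij, hjk, h1, h2⟩

theorem minInvTop_prependPerm_zero {n : ℕ} (σ : Equiv.Perm (Fin n)) :
    minInvTop (prependPerm σ 0) = minInvTop σ + 1 := by
  have key : ∀ w, BelowInversions (prependPerm σ 0) (w + 1) ↔ BelowInversions σ w := by
    intro w
    constructor
    · rintro ⟨h1, h2⟩
      refine ⟨by omega, fun i j hij hs => ?_⟩
      have := h2 i.succ j.succ (by simpa using hij) (by simpa using hs)
      simpa using this
    · rintro ⟨h1, h2⟩
      refine ⟨by omega, fun i j hij hs => ?_⟩
      cases j using Fin.cases with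
      | zero => exact absurd hij (Fin.not_lt_zero i)
      | succ j =>
      cases i using Fin.cases with
      | zero => simp at hs
      | succ i =>
        have := h2 i j (by simpa using hij) (by simpa using hs)
        simpa using this
  have h1 : minInvTop σ + 1 ≤ minInvTop (prependPerm σ 0) := by
    rw [le_minInvTop_iff, key, ← le_minInvTop_iff]
  obtain ⟨m, hm⟩ : ∃ m, minInvTop (prependPerm σ 0) = m + 1 :=
    ⟨minInvTop (prependPerm σ 0) - 1, by omega⟩
  have h2 : m ≤ minInvTop σ := by
    rw [le_minInvTop_iff, ← key, ← le_minInvTop_iff, hm]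
  omega

theorem minInvTop_prependPerm {n : ℕ} (σ : Equiv.Perm (Fin n)) (v : Fin (n + 1))
    (hv : v ≠ 0) (hle : v.val ≤ minInvTop σ) : minInvTop (prependPerm σ v) = v.val := by
  have hpos : 0 < v.val := Nat.pos_of_ne_zero fun h => hv (Fin.ext h)
  have hn : 0 < n := by have := v.isLt; omega
  apply le_antisymm
  · have h := ((le_minInvTop_iff (prependPerm σ v) _).1 le_rfl).2 0 (σ.symm ⟨0, hn⟩).succ
      (Fin.succ_pos _) (by simpa [succAbove_lt_iff_val] using hpos)
    simpa using h
  · rw [le_minInvTop_iff] at hle ⊢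
    refine ⟨by omega, fun i j hij hs => ?_⟩
    cases j using Fin.cases with
    | zero => exact absurd hij (Fin.not_lt_zero i)
    | succ j =>
    cases i using Fin.cases with
    | zero => simp
    | succ i =>
      have h := hle.2 i j (by simpa using hij) (by simpa using hs)
      rw [prependPerm_succ]
      by_contra hlt
      have := (succAbove_lt_iff_val v (σ i)).1 (Fin.lt_def.2 (not_le.1 hlt))
      omega

theorem succ_mem_DesPerm_prependPerm {n : ℕ} (σ : Equiv.Perm (Fin n)) (v : Fin (n + 1))
    (i : Fin n) : i.succ ∈ DesPerm (prependPerm σ v) ↔ i ∈ DesPerm σ := by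
  simp only [DesPerm, mem_filter, mem_univ, true_and]
  constructor
  · rintro ⟨h, hs⟩
    have h' : i.val + 1 < n := by simpa using h
    refine ⟨h', ?_⟩
    have e : (⟨i.succ.val + 1, h⟩ : Fin (n + 1)) = Fin.succ ⟨i.val + 1, h'⟩ := rfl
    rwa [e, prependPerm_succ, prependPerm_succ, Fin.succAbove_lt_succAbove_iff] at hs
  · rintro ⟨h, hs⟩
    refine ⟨by simpa using h, ?_⟩
    have e : (⟨i.succ.val + 1, by simpa using h⟩ : Fin (n + 1)) = Fin.succ ⟨i.val + 1, h⟩ := rfl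
    rwa [e, prependPerm_succ, prependPerm_succ, Fin.succAbove_lt_succAbove_iff]

theorem zero_mem_DesPerm_prependPerm {n : ℕ} (σ : Equiv.Perm (Fin n)) (v : Fin (n + 1))
    (hle : v.val ≤ minInvTop σ) :
    0 ∈ DesPerm (prependPerm σ v) ↔ v ≠ 0 ∧ FixesFirst σ := by
  simp only [DesPerm, mem_filter, mem_univ, true_and]
  rw [le_minInvTop_iff] at hle
  constructor
  · rintro ⟨h, hs⟩
    have hn : 0 < n := by simpa using h
    have e : (⟨(0 : Fin (n + 1)).val + 1, h⟩ : Fin (n + 1)) = Fin.succ ⟨0, hn⟩ := by ext; simp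
    rw [e, prependPerm_succ, prependPerm_zero, succAbove_lt_iff_val] at hs
    refine ⟨fun h0 => by simp [h0] at hs, fun _ => ?_⟩
    by_contra hne
    have hpos : 0 < (σ ⟨0, hn⟩).val := Nat.pos_of_ne_zero fun h => hne (Fin.ext h)
    have hinv := hle.2 ⟨0, hn⟩ (σ.symm ⟨0, hn⟩)
      (Fin.lt_def.2 (Nat.pos_of_ne_zero fun h => hne (by
        have : σ.symm ⟨0, hn⟩ = ⟨0, hn⟩ := Fin.ext h
        rw [Equiv.symm_apply_eq] at this
        exact this.symm)))
      (by simpa [Fin.lt_def] using hpos)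
    omega
  · rintro ⟨hv, hf⟩
    have hpos : 0 < v.val := Nat.pos_of_ne_zero fun h => hv (Fin.ext h)
    have hn : 0 < n := by have := v.isLt; omega
    refine ⟨by simpa using hn, ?_⟩
    have e : (⟨(0 : Fin (n + 1)).val + 1, by simpa using hn⟩ : Fin (n + 1)) =
      Fin.succ ⟨0, hn⟩ := by ext; simp
    rw [e, prependPerm_succ, prependPerm_zero, succAbove_lt_iff_val, hf hn]
    exact hpos

theorem sum_DesPerm_prependPerm {n : ℕ} (σ : Equiv.Perm (Fin n)) (v : Fin (n + 1))
    (hle : v.val ≤ minInvTop σ) (f : ℕ → ℕ) :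
    ∑ i ∈ DesPerm (prependPerm σ v), f i.val =
      (if v ≠ 0 ∧ FixesFirst σ then f 0 else 0) + ∑ i ∈ DesPerm σ, f (i.val + 1) := by
  have h : ∀ {m : ℕ} (s : Finset (Fin m)) (g : Fin m → ℕ),
      ∑ i ∈ s, g i = ∑ i, if i ∈ s then g i else 0 := by
    intro m s g
    simp
  rw [h, h (DesPerm σ), Fin.sum_univ_succ]
  simp only [zero_mem_DesPerm_prependPerm σ v hle, succ_mem_DesPerm_prependPerm]
  simp

/-- The monomial `q^{maj σ} t^{des σ}`. -/
noncomputable def majDesMonomial {n : ℕ} (σ : Equiv.Perm (Fin n)) : MvPolynomial (Fin 2) ℤ :=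
  X 0 ^ majPerm σ * X 1 ^ desPerm σ

theorem subT_add (k : ℕ) (f g : MvPolynomial (Fin 2) ℤ) :
    subT k (f + g) = subT k f + subT k g := map_add (bind₁ _) f g

theorem subT_sub (k : ℕ) (f g : MvPolynomial (Fin 2) ℤ) :
    subT k (f - g) = subT k f - subT k g := map_sub (bind₁ _) f g

theorem subT_mul (k : ℕ) (f g : MvPolynomial (Fin 2) ℤ) :
    subT k (f * g) = subT k f * subT k g := map_mul (bind₁ _) f g

theorem subT_pow (k : ℕ) (f : MvPolynomial (Fin 2) ℤ) (m : ℕ) :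
    subT k (f ^ m) = subT k f ^ m := map_pow (bind₁ _) f m

theorem subT_zero (k : ℕ) : subT k 0 = 0 := map_zero (bind₁ _)

theorem subT_one (k : ℕ) : subT k 1 = 1 := map_one (bind₁ _)

theorem subT_sum {ι : Type*} (k : ℕ) (s : Finset ι) (f : ι → MvPolynomial (Fin 2) ℤ) :
    subT k (∑ i ∈ s, f i) = ∑ i ∈ s, subT k (f i) := map_sum (bind₁ _) f s

theorem subT_X_zero (k : ℕ) : subT k (X 0) = X 0 := by simp [subT]

theorem subT_X_one (k : ℕ) : subT k (X 1) = X 0 ^ k * X 1 := by simp [subT]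

theorem subT_one_subT (k : ℕ) (f : MvPolynomial (Fin 2) ℤ) :
    subT 1 (subT k f) = subT (k + 1) f := by
  have h : ((bind₁ (fun i : Fin 2 => if i = 0 then X 0 else X 0 ^ 1 * X 1)).comp
      (bind₁ (fun i : Fin 2 => if i = 0 then X 0 else X 0 ^ k * X 1)) :
        MvPolynomial (Fin 2) ℤ →ₐ[ℤ] MvPolynomial (Fin 2) ℤ) =
      bind₁ (fun i : Fin 2 => if i = 0 then X 0 else X 0 ^ (k + 1) * X 1) := by
    ext1 i
    fin_cases i
    · simp
    · simp
      ring
  exact congrArg (fun g => g f) h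

theorem majDesMonomial_prependPerm {n : ℕ} (σ : Equiv.Perm (Fin n)) (v : Fin (n + 1))
    (hle : v.val ≤ minInvTop σ) :
    majDesMonomial (prependPerm σ v) =
      (if v ≠ 0 ∧ FixesFirst σ then X 0 * X 1 else 1) * subT 1 (majDesMonomial σ) := by
  have hmaj : majPerm (prependPerm σ v) =
      (if v ≠ 0 ∧ FixesFirst σ then 1 else 0) + (majPerm σ + desPerm σ) := by
    have h := sum_DesPerm_prependPerm σ v hle (fun i => i + 1)
    simpa only [sum_add_distrib, sum_const, smul_eq_mul, mul_one, majPerm, desPerm,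
      zero_add, add_assoc] using h
  have hdes : desPerm (prependPerm σ v) =
      (if v ≠ 0 ∧ FixesFirst σ then 1 else 0) + desPerm σ := by
    simpa [desPerm] using sum_DesPerm_prependPerm σ v hle (fun _ => 1)
  simp only [majDesMonomial, subT_mul, subT_pow, subT_X_zero, subT_X_one, hmaj, hdes]
  split_ifs <;> ring

theorem sum_Av_succ {R : Type*} [AddCommMonoid R] (n : ℕ) (G : Equiv.Perm (Fin (n + 1)) → R) :
    ∑ τ ∈ Av (n + 1), G τ =
      ∑ σ ∈ Av n, ∑ v : Fin (n + 1), if v.val ≤ minInvTop σ then G (prependPerm σ v) else 0 := by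
  simp only [Av, sum_filter]
  rw [← (Equiv.ofBijective _ (prependPerm_bijective n)).sum_comp, Fintype.sum_prod_type]
  refine sum_congr rfl fun σ _ => ?_
  simp only [Equiv.ofBijective_apply, avoids321_prependPerm]
  by_cases h : Avoids321 σ <;> simp [h]

/-- The part of `MPoly n` coming from permutations `σ` with `minInvTop σ = d` that fix the
first letter. -/
noncomputable def MFix (n d : ℕ) : MvPolynomial (Fin 2) ℤ :=
  ∑ σ ∈ Av n, if minInvTop σ = d ∧ FixesFirst σ then majDesMonomial σ else 0

/-- The part of `MPoly n` coming from permutations `σ` with `minInvTop σ = d` that do not fix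
the first letter. -/
noncomputable def MMove (n d : ℕ) : MvPolynomial (Fin 2) ℤ :=
  ∑ σ ∈ Av n, if minInvTop σ = d ∧ ¬ FixesFirst σ then majDesMonomial σ else 0

theorem MPoly_eq_sum {n N : ℕ} (hN : n < N) :
    MPoly n = ∑ d ∈ range N, (MFix n d + MMove n d) := by
  simp only [MFix, MMove, ← sum_add_distrib]
  rw [sum_comm]
  refine sum_congr rfl fun σ _ => ?_
  rw [sum_eq_single (minInvTop σ)]
  · by_cases h : FixesFirst σ <;> simp [h, majDesMonomial]
  · intro d _ hd
    simp [hd.symm]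
  · intro h
    have := minInvTop_le σ
    exact absurd (mem_range.2 (by omega)) h

theorem MFix_succ_succ (n d : ℕ) :
    MFix (n + 1) (d + 1) = subT 1 (MFix n d + MMove n d) := by
  rw [MFix, sum_Av_succ, MFix, MMove, ← sum_add_distrib, subT_sum]
  refine sum_congr rfl fun σ _ => ?_
  rw [sum_eq_single 0]
  · rw [majDesMonomial_prependPerm σ 0 (by simp)]
    by_cases h : FixesFirst σ <;> by_cases hd : minInvTop σ = d <;>
      simp [fixesFirst_prependPerm, minInvTop_prependPerm_zero, h, hd, subT_zero]
  · intro v _ hv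
    simp [fixesFirst_prependPerm, hv]
  · simp

theorem MFix_succ_zero (n : ℕ) : MFix (n + 1) 0 = 0 := by
  rw [MFix, sum_Av_succ]
  refine sum_eq_zero fun σ _ => sum_eq_zero fun v _ => ?_
  by_cases hv : v = 0
  · subst hv
    simp [minInvTop_prependPerm_zero]
  · simp [fixesFirst_prependPerm, hv]

theorem MMove_succ_zero (n : ℕ) : MMove (n + 1) 0 = 0 := by
  rw [MMove, sum_Av_succ]
  refine sum_eq_zero fun σ _ => sum_eq_zero fun v _ => ?_
  by_cases hv : v = 0
  · simp [fixesFirst_prependPerm, hv]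
  · by_cases hle : v.val ≤ minInvTop σ
    · simp [minInvTop_prependPerm σ v hv hle, hv]
    · simp [hle]

theorem MMove_succ_succ {n N : ℕ} (hN : n < N) (j : ℕ) :
    MMove (n + 1) (j + 1) =
      ∑ d ∈ Ico (j + 1) N, (subT 1 (MMove n d) + X 0 * X 1 * subT 1 (MFix n d)) := by
  simp only [MMove, MFix, subT_sum, mul_sum, ← sum_add_distrib]
  rw [sum_Av_succ, eq_comm, sum_comm, eq_comm]
  refine sum_congr rfl fun σ _ => ?_
  have hn := minInvTop_le σ
  by_cases hj : j + 1 ≤ minInvTop σ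
  · have hjn : j + 1 < n + 1 := by omega
    rw [sum_eq_single (⟨j + 1, hjn⟩ : Fin (n + 1)), sum_eq_single (minInvTop σ)]
    · have hv : (⟨j + 1, hjn⟩ : Fin (n + 1)) ≠ 0 := by simp [Fin.ext_iff]
      rw [majDesMonomial_prependPerm σ ⟨j + 1, hjn⟩ hj, minInvTop_prependPerm σ _ hv hj]
      by_cases h : FixesFirst σ <;> simp [fixesFirst_prependPerm, h, hj, subT_zero, hv]
    · intro d _ hd
      simp [hd.symm, subT_zero]
    · intro h
      exact absurd (mem_Ico.2 ⟨hj, by omega⟩) h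
    · intro v _ hv
      by_cases hle : v.val ≤ minInvTop σ
      · by_cases h0 : v = 0
        · simp [fixesFirst_prependPerm, h0]
        · have : v.val ≠ j + 1 := fun h => hv (Fin.ext h)
          simp [minInvTop_prependPerm σ v h0 hle, this]
      · simp [hle]
    · simp
  · rw [sum_eq_zero, sum_eq_zero]
    · intro d hd
      have : minInvTop σ ≠ d := by have := (mem_Ico.1 hd).1; omega
      simp [this, subT_zero]
    · intro v _
      by_cases hle : v.val ≤ minInvTop σ
      · by_cases h0 : v = 0
        · simp [fixesFirst_prependPerm, h0]
        · have : v.val ≠ j + 1 := by omega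
          simp [minInvTop_prependPerm σ v h0 hle, this]
      · simp [hle]

theorem fixesFirst_of_zero (σ : Equiv.Perm (Fin 0)) : FixesFirst σ :=
  fun h => absurd h (lt_irrefl 0)

theorem MMove_zero (d : ℕ) : MMove 0 d = 0 := by
  simp [MMove, fixesFirst_of_zero]

theorem MFix_zero_succ (d : ℕ) : MFix 0 (d + 1) = 0 := by
  refine sum_eq_zero fun σ _ => ?_
  have := minInvTop_le σ
  rw [if_neg]
  omega

theorem MPoly_zero : MPoly 0 = 1 := by
  have h : Av 0 = {1} := by decide
  simp [MPoly, h, majPerm, desPerm, DesPerm]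

theorem MFix_zero_zero : MFix 0 0 = 1 := by
  have h := MPoly_eq_sum (n := 0) (N := 1) one_pos
  simpa [MPoly_zero, MMove_zero] using h.symm

/-- `M_m(q, q^k t) + (q^k t - 1) M_{m-1}(q, q^{k+1} t)`, read as `1` for `m = 0`: the sum over
`τ ∈ Av m` of `q^{maj τ} (q^k t)^{des τ}`, with an extra factor `q^k t` if `τ` is nonempty and
fixes the first letter. -/
noncomputable def tailFactor : ℕ → ℕ → MvPolynomial (Fin 2) ℤ
  | 0, _ => 1
  | m + 1, k => subT k (MPoly (m + 1)) + (X 0 ^ k * X 1 - 1) * subT (k + 1) (MPoly m)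

theorem subT_one_tailFactor (m k : ℕ) : subT 1 (tailFactor m k) = tailFactor m (k + 1) := by
  cases m with
  | zero => exact subT_one 1
  | succ m =>
    simp only [tailFactor, subT_add, subT_sub, subT_mul, subT_pow, subT_one_subT, subT_one,
      subT_X_zero, subT_X_one]
    ring

theorem MFix_succ_one (n : ℕ) : MFix (n + 1) 1 = if n = 0 then 1 else 0 := by
  rw [MFix_succ_succ]
  cases n with
  | zero => simp [MFix_zero_zero, MMove_zero, subT_one]
  | succ n => simp [MFix_succ_zero, MMove_succ_zero, subT_zero]

theorem sum_MFix_succ {n N : ℕ} (hN : n < N) :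
    ∑ d ∈ range (N + 1), MFix (n + 1) d = subT 1 (MPoly n) := by
  rw [sum_range_succ', MFix_succ_zero, add_zero, MPoly_eq_sum hN, subT_sum]
  exact sum_congr rfl fun d _ => MFix_succ_succ n d

theorem sum_level_one (n : ℕ) : MFix (n + 1) 1 + MMove (n + 1) 1 = tailFactor n 1 := by
  cases n with
  | zero => simp [MFix_succ_one, MMove_succ_succ (n := 0) (N := 1) one_pos 0, tailFactor]
  | succ n =>
    have h1 := MPoly_eq_sum (n := n + 1) (N := n + 2) (by omega)
    have h2 := sum_MFix_succ (n := n) (N := n + 1) (by omega)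
    rw [range_eq_Ico, sum_eq_sum_Ico_succ_bot (by omega)] at h1 h2
    simp only [MFix_succ_zero, MMove_succ_zero, zero_add] at h1 h2
    rw [MFix_succ_one, if_neg (Nat.succ_ne_zero n),
      MMove_succ_succ (n := n + 1) (N := n + 2) (by omega) 0, tailFactor, h1,
      ← subT_one_subT 1, ← h2]
    simp only [sum_add_distrib, subT_add, subT_sum, mul_sum, sum_sub_distrib, sub_mul, one_mul, pow_one,
      zero_add]
    ring

theorem MFix_MMove_convolution (n : ℕ) : ∀ d,
    MFix (n + 1) (d + 2) =
        ∑ j ∈ range (n + 1), MFix j (d + 1) * tailFactor (n - j) (j + 1) ∧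
      MMove (n + 1) (d + 2) =
        ∑ j ∈ range (n + 1), MMove j (d + 1) * tailFactor (n - j) (j + 1) := by
  induction n with
  | zero =>
    intro d
    simp [MFix_succ_succ, MMove_succ_succ (n := 0) (N := 1) one_pos, MFix_zero_succ, MMove_zero,
      subT_zero]
  | succ n ih =>
    intro d
    constructor
    · rw [MFix_succ_succ, sum_range_succ', MFix_zero_succ, zero_mul, add_zero]
      simp only [Nat.add_sub_add_right]
      cases d with
      | zero =>
        rw [sum_level_one, subT_one_tailFactor, sum_range_succ']
        simp [MFix_succ_one]
      | succ d =>
        rw [(ih d).1, (ih d).2, ← sum_add_distrib, subT_sum]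
        refine sum_congr rfl fun j _ => ?_
        rw [MFix_succ_succ, ← add_mul, subT_mul, subT_one_tailFactor]
    · rw [MMove_succ_succ (n := n + 1) (N := n + 3) (by omega), sum_range_succ', MMove_zero,
        zero_mul, add_zero]
      simp only [Nat.add_sub_add_right]
      rw [← sum_Ico_add' _ (d + 1) (n + 2) 1]
      have hstep : ∀ j ∈ range (n + 1), MMove (j + 1) (d + 1) * tailFactor (n - j) (j + 1 + 1) =
          ∑ e ∈ Ico (d + 1) (n + 2),
            (subT 1 (MMove j e) + X 0 * X 1 * subT 1 (MFix j e)) *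
              tailFactor (n - j) (j + 1 + 1) := by
        intro j hj
        have := mem_range.1 hj
        rw [MMove_succ_succ (n := j) (N := n + 2) (by omega), sum_mul]
      rw [sum_congr rfl hstep, sum_comm]
      refine sum_congr rfl fun e he => ?_
      obtain ⟨e, rfl⟩ : ∃ m, e = m + 1 := ⟨e - 1, by have := (mem_Ico.1 he).1; omega⟩
      rw [(ih e).1, (ih e).2, subT_sum, subT_sum, mul_sum, ← sum_add_distrib]
      refine sum_congr rfl fun j _ => ?_
      rw [subT_mul, subT_mul, subT_one_tailFactor]
      ring

theorem MPoly_succ_convolution (n : ℕ) :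
    MPoly (n + 1) = ∑ j ∈ range (n + 1), MPoly j * tailFactor (n - j) (j + 1) := by
  rw [MPoly_eq_sum (N := n + 3) (by omega), sum_range_succ', sum_range_succ', sum_level_one,
    MFix_succ_zero, MMove_succ_zero, sum_range_succ' (fun j => MPoly j * _)]
  simp only [(MFix_MMove_convolution n _).1, (MFix_MMove_convolution n _).2, ← sum_add_distrib,
    ← add_mul]
  rw [sum_comm, sum_range_succ', MPoly_zero]
  simp only [MFix_zero_succ, MMove_zero, add_zero, zero_mul, sum_const_zero, one_mul,
    Nat.sub_zero, zero_add]
  congr 1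
  refine sum_congr rfl fun j hj => ?_
  have := mem_range.1 hj
  rw [← sum_mul, MPoly_eq_sum (n := j + 1) (N := n + 2) (by omega),
    sum_range_succ' _ (n + 1), MFix_succ_zero, MMove_succ_zero, add_zero, add_zero]

/-- for n ≥ 1,
`M_n(q,t) = M_{n-1}(q,qt) + Σ_{k=2}^{n} [M_{k-1}(q,t) + (q^{k-1}t - 1)M_{k-2}(q,t)]·M_{n-k}(q,q^k t)`. -/
theorem stmt10 (n : ℕ) (hn : 1 ≤ n) :
    MPoly n = subT 1 (MPoly (n - 1)) +
      ∑ k ∈ Finset.Icc 2 n,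
        (MPoly (k - 1) + (X 0 ^ (k - 1) * X 1 - 1) * MPoly (k - 2)) * subT k (MPoly (n - k)) := by
  obtain ⟨m, rfl⟩ : ∃ m, n = m + 1 := ⟨n - 1, by omega⟩
  have hIcc : ∀ f : ℕ → MvPolynomial (Fin 2) ℤ,
      ∑ k ∈ Icc 2 (m + 1), f k = ∑ j ∈ range m, f (j + 2) := by
    intro f
    rw [← Ico_add_one_right_eq_Icc, sum_Ico_eq_sum_range]
    exact sum_congr (by simp) fun j _ => by rw [add_comm]
  have htail : ∀ j ∈ range m, MPoly j * tailFactor (m - j) (j + 1) =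
      MPoly j * subT (j + 1) (MPoly (m - j)) +
        (X 0 ^ (j + 1) * X 1 - 1) * MPoly j * subT (j + 2) (MPoly (m - (j + 1))) := by
    intro j hj
    obtain ⟨r, rfl⟩ : ∃ r, m = j + (r + 1) := ⟨m - j - 1, by have := mem_range.1 hj; omega⟩
    rw [show j + (r + 1) - j = r + 1 by omega, show j + (r + 1) - (j + 1) = r by omega,
      tailFactor]
    ring
  have hlast : MPoly m * tailFactor (m - m) (m + 1) =
      MPoly m * subT (m + 1) (MPoly (m - m)) := by
    simp [tailFactor, MPoly_zero, subT_one]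
  rw [MPoly_succ_convolution, sum_range_succ, sum_congr rfl htail, sum_add_distrib, hlast,
    add_right_comm, ← sum_range_succ (fun j => MPoly j * subT (j + 1) (MPoly (m - j))),
    sum_range_succ', hIcc]
  simp only [add_mul, sum_add_distrib, MPoly_zero, one_mul, Nat.sub_zero, zero_add,
    Nat.add_sub_cancel, show ∀ j, j + 2 - 1 = j + 1 from fun _ => rfl,
    show ∀ j, m + 1 - (j + 2) = m - (j + 1) from fun j => by omega]
  ring
end

section
/- For every integer n ≥ 1, M_n(q,t) = M_{n-1}(q,t) + Σ_{k=0}^{n-2} M_k(q,t)·[M_{n-k-1}(q,q^{k}t) + (q^{n-1}t − 1)M_{n-k-2}(q,q^{k}t)], as an identity in ℤ[q,t], where M_m(q,u) denotes the polynomial M_m(q,t) with t replaced by u. -/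
open Finset MvPolynomial

/-- `g` encodes a Dyck path of semilength `n`: it is a monotone function lying weakly above the
identity, it preserves `{0, …, n-1}`, and it is the identity from `n` on. -/
def IsBallot (n : ℕ) (g : ℕ → ℕ) : Prop :=
  Monotone g ∧ (∀ i, i ≤ g i) ∧ (∀ i < n, g i < n) ∧ ∀ i, n ≤ i → g i = i

theorem finite_isBallot (n : ℕ) : {g | IsBallot n g}.Finite := by
  refine Set.Finite.of_finite_image (f := fun g (i : Fin n) => g i) ?_ ?_
  · refine (Set.Finite.pi' (t := fun _ : Fin n => Set.Iio n)
      fun _ => Set.finite_Iio n).subset ?_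
    rintro _ ⟨g, hg, rfl⟩ i
    exact hg.2.2.1 i i.2
  · intro g hg g' hg' h
    funext i
    by_cases hi : i < n
    · exact congrFun h ⟨i, hi⟩
    · rw [hg.2.2.2 i (by omega), hg'.2.2.2 i (by omega)]

/-- The finite set of ballot functions of size `n`. -/
noncomputable def ballotSet (n : ℕ) : Finset (ℕ → ℕ) := (finite_isBallot n).toFinset

theorem mem_ballotSet {n : ℕ} {g : ℕ → ℕ} : g ∈ ballotSet n ↔ IsBallot n g := by
  simp [ballotSet]

/-- `i` is a record of `g`. -/
def IsRecord (g : ℕ → ℕ) (i : ℕ) : Prop := ∀ j < i, g j < g i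

/-- `i` is a record of `g` immediately followed by a non-record. -/
def IsDrop (g : ℕ → ℕ) (i : ℕ) : Prop := IsRecord g i ∧ g (i + 1) = g i

open Classical in
/-- The weight of `g`, with positions shifted by `k`. -/
noncomputable def dropWeight (k n : ℕ) (g : ℕ → ℕ) : MvPolynomial (Fin 2) ℤ :=
  ∏ i ∈ range n, if IsDrop g i then X 0 ^ (k + i + 1) * X 1 else 1

/-- The running maximum of a permutation, extended by the identity. -/
def runMax {n : ℕ} (σ : Equiv.Perm (Fin n)) (i : ℕ) : ℕ :=
  if i < n then (univ.filter fun j : Fin n => j.val ≤ i).sup fun j => (σ j).val else i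

theorem le_runMax {n : ℕ} (σ : Equiv.Perm (Fin n)) {j : Fin n} {i : ℕ} (h : j.val ≤ i)
    (hi : i < n) : (σ j).val ≤ runMax σ i := by
  rw [runMax, if_pos hi]
  exact Finset.le_sup (f := fun j => (σ j).val) (by simpa using h)

theorem exists_eq_runMax {n : ℕ} (σ : Equiv.Perm (Fin n)) {i : ℕ} (hi : i < n) :
    ∃ j : Fin n, j.val ≤ i ∧ (σ j).val = runMax σ i := by
  rw [runMax, if_pos hi]
  obtain ⟨j, hj, h⟩ := Finset.exists_mem_eq_sup (univ.filter fun j : Fin n => j.val ≤ i)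
    ⟨⟨i, hi⟩, by simp⟩ fun j => (σ j).val
  exact ⟨j, by simpa using hj, h.symm⟩

theorem runMax_eq_iff {n : ℕ} (σ : Equiv.Perm (Fin n)) {i : ℕ} (hi : i < n) {m : ℕ}
    (h1 : ∀ j : Fin n, j.val ≤ i → (σ j).val ≤ m) (h2 : ∃ j : Fin n, j.val ≤ i ∧ (σ j).val = m) :
    runMax σ i = m := by
  obtain ⟨j, hj, rfl⟩ := h2
  obtain ⟨j', hj', h⟩ := exists_eq_runMax σ hi
  exact le_antisymm (h ▸ h1 j' hj') (le_runMax σ hj hi)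

theorem runMax_of_le {n : ℕ} (σ : Equiv.Perm (Fin n)) {i : ℕ} (hi : n ≤ i) :
    runMax σ i = i := if_neg (by omega)

theorem runMax_lt {n : ℕ} (σ : Equiv.Perm (Fin n)) {i : ℕ} (hi : i < n) : runMax σ i < n := by
  obtain ⟨j, -, h⟩ := exists_eq_runMax σ hi
  exact h ▸ (σ j).2

theorem isBallot_runMax {n : ℕ} (σ : Equiv.Perm (Fin n)) : IsBallot n (runMax σ) := by
  refine ⟨?_, ?_, fun i hi => runMax_lt σ hi, fun i hi => runMax_of_le σ hi⟩
  · intro a b hab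
    by_cases hb : b < n
    · obtain ⟨j, hj, h⟩ := exists_eq_runMax σ (hab.trans_lt hb)
      exact h ▸ le_runMax σ (hj.trans hab) hb
    · rw [runMax_of_le σ (not_lt.1 hb)]
      by_cases ha : a < n
      · have := runMax_lt σ ha
        omega
      · rwa [runMax_of_le σ (not_lt.1 ha)]
  · intro i
    by_cases hi : i < n
    · by_contra! hlt
      have hmaps : ∀ j ∈ Finset.univ.filter (fun j : Fin n => j.val ≤ i),
          (σ j).val ∈ range (runMax σ i + 1) := fun j hj => by
        have := le_runMax σ (by simpa using hj) hi
        simp only [mem_range]; omega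
      have hcard := Finset.card_le_card_of_injOn _ hmaps
        (fun a _ b _ hab => σ.injective (Fin.ext hab))
      have hc : (Finset.univ.filter (fun j : Fin n => j.val ≤ i)).card = i + 1 := by
        have : (Finset.univ.filter (fun j : Fin n => j.val ≤ i)) = Finset.Iic ⟨i, hi⟩ := by
          ext j; simp [Fin.le_def]
        rw [this, Fin.card_Iic]
      rw [hc, card_range] at hcard
      omega
    · rw [runMax_of_le σ (not_lt.1 hi)]

theorem avoids321_iff {n : ℕ} {σ : Equiv.Perm (Fin n)} : σ ∈ Av n ↔
    ∀ i j k : Fin n, i < j → j < k → σ k < σ j → σ j < σ i → False := by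
  simp only [Av, Avoids321, mem_filter, mem_univ, true_and]
  grind

/-- A position whose value is below the running maximum has a larger value before it. -/
theorem exists_lt_of_lt_runMax {n : ℕ} {σ : Equiv.Perm (Fin n)} {i : Fin n}
    (h : (σ i).val < runMax σ i) : ∃ j < i, σ i < σ j := by
  obtain ⟨j, hj, hj'⟩ := exists_eq_runMax σ i.2
  refine ⟨j, lt_of_le_of_ne hj ?_, by rw [Fin.lt_def]; omega⟩
  rintro rfl
  omega

theorem isRecord_runMax_iff {n : ℕ} {σ : Equiv.Perm (Fin n)} {i : Fin n} :
    IsRecord (runMax σ) i ↔ (σ i).val = runMax σ i := by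
  constructor
  · intro h
    obtain ⟨j, hj, hj'⟩ := exists_eq_runMax σ i.2
    rcases hj.lt_or_eq with hlt | heq
    · have := h j hlt
      have := le_runMax σ le_rfl j.2
      omega
    · rw [← hj', Fin.ext heq]
  · intro h j hj
    obtain ⟨j', h1, h2⟩ := exists_eq_runMax σ (hj.trans i.2)
    have h3 := le_runMax σ (h1.trans hj.le) i.2
    have h4 : (σ j').val ≠ σ i := fun h5 => by
      have := congrArg Fin.val (σ.injective (Fin.ext h5))
      omega
    omega

theorem mem_desPerm_iff {n : ℕ} {σ : Equiv.Perm (Fin n)} (hσ : σ ∈ Av n) {i : Fin n} :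
    i ∈ DesPerm σ ↔ IsDrop (runMax σ) i := by
  rw [avoids321_iff] at hσ
  simp only [DesPerm, mem_filter, mem_univ, true_and, IsDrop, isRecord_runMax_iff]
  have hii := le_runMax σ (le_refl i.val) i.2
  constructor
  · rintro ⟨h, hlt⟩
    have hrec : (σ i).val = runMax σ i := by
      by_contra hne
      obtain ⟨j, hj, hj'⟩ := exists_lt_of_lt_runMax (lt_of_le_of_ne hii hne)
      exact hσ j i ⟨i + 1, h⟩ hj (Fin.lt_def.2 (Nat.lt_succ_self _)) hlt hj'
    refine ⟨hrec, runMax_eq_iff σ h (fun j hj => ?_) ⟨i, by simp, hrec⟩⟩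
    rcases hj.lt_or_eq with hj | hj
    · exact le_runMax σ (by omega) i.2
    · have : j = ⟨i + 1, h⟩ := Fin.ext hj
      rw [this, ← hrec]
      exact hlt.le
  · rintro ⟨hrec, heq⟩
    have h : i.val + 1 < n := by
      by_contra h
      rw [runMax_of_le σ (not_lt.1 h)] at heq
      have := runMax_lt σ i.2
      omega
    refine ⟨h, lt_of_le_of_ne ?_ fun hc => ?_⟩
    · rw [Fin.le_def, hrec, ← heq]
      exact le_runMax σ le_rfl h
    · have := congrArg Fin.val (σ.injective hc)
      simp at this

theorem weight_eq_dropWeight {n : ℕ} {σ : Equiv.Perm (Fin n)} (hσ : σ ∈ Av n) :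
    (X 0 ^ majPerm σ * X 1 ^ desPerm σ : MvPolynomial (Fin 2) ℤ) = dropWeight 0 n (runMax σ) := by
  classical
  rw [dropWeight, majPerm, desPerm, ← Finset.prod_pow_eq_pow_sum, ← Finset.prod_const,
    ← Finset.prod_mul_distrib, ← Fin.prod_univ_eq_prod_range
      (fun i => if IsDrop (runMax σ) i then (X 0 ^ (0 + i + 1) * X 1 : MvPolynomial (Fin 2) ℤ)
        else 1), ← Finset.prod_filter]
  refine Finset.prod_congr ?_ fun i _ => by rw [zero_add]
  ext i
  simp [mem_desPerm_iff hσ]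

theorem eq_of_runMax_eq {n : ℕ} {σ τ : Equiv.Perm (Fin n)} (hσ : σ ∈ Av n) (hτ : τ ∈ Av n)
    (h : runMax σ = runMax τ) : σ = τ := by
  rw [avoids321_iff] at hσ hτ
  have key : ∀ {σ τ : Equiv.Perm (Fin n)} {i : Fin n},
      (∀ i j k : Fin n, i < j → j < k → τ k < τ j → τ j < τ i → False) →
      (τ i).val < runMax τ i → (∀ j < i, σ j = τ j) → τ i ≤ σ i := by
    intro σ τ i hτ hlt ih
    by_contra! hc
    obtain ⟨i', hi', hi''⟩ := exists_lt_of_lt_runMax hlt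
    obtain ⟨j, hj⟩ := τ.surjective (σ i)
    rcases lt_trichotomy j i with hji | rfl | hji
    · exact hji.ne (σ.injective ((ih j hji).trans hj))
    · exact hc.ne hj.symm
    · exact hτ i' i j hi' hji (hj ▸ hc) hi''
  have main : ∀ m : ℕ, ∀ i : Fin n, i.val = m → σ i = τ i := by
    intro m
    induction m using Nat.strong_induction_on with
    | _ m ih =>
      rintro i rfl
      have ih' : ∀ j < i, σ j = τ j := fun j hj => ih j hj j rfl
      by_cases hrec : IsRecord (runMax σ) i
      · have h1 := isRecord_runMax_iff.1 hrec
        have h2 := isRecord_runMax_iff.1 (h ▸ hrec)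
        exact Fin.ext (by rw [h1, h2, h])
      · have h1 := mt isRecord_runMax_iff.2 hrec
        have h2 := mt isRecord_runMax_iff.2 (h ▸ hrec)
        have h3 := le_runMax σ (le_refl i.val) i.2
        have h4 := le_runMax τ (le_refl i.val) i.2
        exact le_antisymm
          (key hσ (lt_of_le_of_ne h3 h1) fun j hj => (ih' j hj).symm)
          (key hτ (lt_of_le_of_ne h4 h2) ih')
  exact Equiv.ext fun i => main i i rfl

open Classical in
/-- The permutation with given running maximum `g`, as a function on `ℕ`: records keep their
value, and the non-record positions receive the remaining values in increasing order. -/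
noncomputable def fillFun (n : ℕ) (g : ℕ → ℕ) (i : ℕ) : ℕ :=
  if IsRecord g i then g i else
    Nat.nth (fun v => ¬ ∃ j < n, IsRecord g j ∧ g j = v) (Nat.count (fun j => ¬ IsRecord g j) i)

theorem infinite_nonrecord_values (n : ℕ) (g : ℕ → ℕ) :
    (Set.ofPred fun v => ¬ ∃ j < n, IsRecord g j ∧ g j = v).Infinite := by
  have : (Set.ofPred fun v => ∃ j < n, IsRecord g j ∧ g j = v).Finite :=
    ((Set.finite_Iio n).image g).subset (by rintro _ ⟨j, hj, -, rfl⟩; exact ⟨j, hj, rfl⟩)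
  exact this.infinite_compl

theorem exists_isRecord_eq (g : ℕ → ℕ) (hg : Monotone g) (i : ℕ) :
    ∃ j ≤ i, IsRecord g j ∧ g j = g i := by
  classical
  have hex : ∃ j, g j = g i := ⟨i, rfl⟩
  refine ⟨Nat.find hex, Nat.find_min' hex rfl, fun j hj => ?_, Nat.find_spec hex⟩
  refine lt_of_le_of_ne (hg hj.le) fun h => Nat.find_min hex hj ?_
  rw [h, Nat.find_spec hex]

theorem fillFun_of_isRecord {n : ℕ} {g : ℕ → ℕ} {i : ℕ} (h : IsRecord g i) :
    fillFun n g i = g i := if_pos h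

theorem fillFun_lt {n : ℕ} {g : ℕ → ℕ} (hg : IsBallot n g) {i : ℕ}
    (h : ¬ IsRecord g i) : fillFun n g i < g i := by
  classical
  rw [fillFun, if_neg h]
  apply Nat.nth_lt_of_lt_count
  obtain ⟨i', hi', hrec, heq⟩ := exists_isRecord_eq g hg.1 i
  have hlt : i' < i := lt_of_le_of_ne hi' fun h' => h (h' ▸ hrec)
  have hsub : (range (g i)).filter (fun v => ∃ j < n, IsRecord g j ∧ g j = v) ⊆
      (((range i).filter (IsRecord g)).erase i').image g := by
    intro v
    simp only [mem_filter, mem_range, mem_image, mem_erase]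
    rintro ⟨hv, j, -, hj, rfl⟩
    refine ⟨j, ⟨?_, ?_, hj⟩, rfl⟩
    · rintro rfl; omega
    · by_contra! hc
      have := hg.1 hc
      omega
  have h1 := (card_le_card hsub).trans card_image_le
  rw [card_erase_of_mem (by simp [hlt, hrec])] at h1
  have hpos : 0 < ((range i).filter (IsRecord g)).card := card_pos.2 ⟨i', by simp [hlt, hrec]⟩
  have h2 := Finset.card_filter_add_card_filter_not (s := range i) (IsRecord g)
  have h3 := Finset.card_filter_add_card_filter_not (s := range (g i))
    (fun v => ∃ j < n, IsRecord g j ∧ g j = v)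
  rw [card_range] at h2 h3
  rw [Nat.count_eq_card_filter_range, Nat.count_eq_card_filter_range]
  have := hg.2.1 i
  omega

theorem fillFun_le {n : ℕ} {g : ℕ → ℕ} (hg : IsBallot n g) (i : ℕ) :
    fillFun n g i ≤ g i := by
  by_cases h : IsRecord g i
  · rw [fillFun_of_isRecord h]
  · exact (fillFun_lt hg h).le

theorem fillFun_lt_fillFun {n : ℕ} {g : ℕ → ℕ} {i j : ℕ} (hij : i < j)
    (hi : ¬ IsRecord g i) (hj : ¬ IsRecord g j) : fillFun n g i < fillFun n g j := by
  classical
  rw [fillFun, if_neg hi, fillFun, if_neg hj]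
  exact Nat.nth_strictMono (infinite_nonrecord_values n g) (Nat.count_strict_mono hi hij)

theorem fillFun_ne {n : ℕ} {g : ℕ → ℕ} {i j : ℕ} (hi : i < n) (hj : j < n) (hij : i < j) :
    fillFun n g i ≠ fillFun n g j := by
  classical
  have key : ∀ {a b : ℕ}, a < n → IsRecord g a → ¬ IsRecord g b →
      fillFun n g a ≠ fillFun n g b := by
    intro a b ha hra hrb h
    have := Nat.nth_mem_of_infinite (infinite_nonrecord_values n g)
      (Nat.count (fun j => ¬ IsRecord g j) b)
    rw [fillFun_of_isRecord hra, fillFun, if_neg hrb] at h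
    exact this ⟨a, ha, hra, h⟩
  by_cases h1 : IsRecord g i <;> by_cases h2 : IsRecord g j
  · rw [fillFun_of_isRecord h1, fillFun_of_isRecord h2]
    exact (h2 i hij).ne
  · exact key hi h1 h2
  · exact (key hj h2 h1).symm
  · exact (fillFun_lt_fillFun hij h1 h2).ne

theorem exists_runMax_eq {n : ℕ} {g : ℕ → ℕ} (hg : IsBallot n g) :
    ∃ σ ∈ Av n, runMax σ = g := by
  classical
  let f : Fin n → Fin n := fun i =>
    ⟨fillFun n g i, (fillFun_le hg i).trans_lt (hg.2.2.1 i i.2)⟩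
  have hf : Function.Injective f := by
    intro i j hij
    have hij' : fillFun n g i = fillFun n g j := congrArg Fin.val hij
    rcases lt_trichotomy i j with h | h | h
    · exact absurd hij' (fillFun_ne i.2 j.2 h)
    · exact h
    · exact absurd hij'.symm (fillFun_ne j.2 i.2 h)
  let σ : Equiv.Perm (Fin n) := Equiv.ofBijective f (Finite.injective_iff_bijective.1 hf)
  have hσ : ∀ i, (σ i).val = fillFun n g i := fun i => rfl
  refine ⟨σ, avoids321_iff.2 ?_, ?_⟩
  · intro i j k hij hjk hkj hji
    rw [Fin.lt_def, hσ, hσ] at hkj hji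
    have hnot : ∀ a b : Fin n, a < b → fillFun n g b < fillFun n g a → ¬ IsRecord g b := by
      intro a b hab hlt hrec
      rw [fillFun_of_isRecord hrec] at hlt
      have := fillFun_le hg a
      have := hg.1 (Fin.lt_def.1 hab).le
      omega
    exact absurd (fillFun_lt_fillFun (n := n) hjk (hnot i j hij hji) (hnot j k hjk hkj)) (by omega)
  · funext i
    by_cases hi : i < n
    · refine runMax_eq_iff σ hi (fun j hj => ?_) ?_
      · rw [hσ]
        exact (fillFun_le hg j).trans (hg.1 hj)
      · obtain ⟨j, hj, hrec, heq⟩ := exists_isRecord_eq g hg.1 i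
        exact ⟨⟨j, hj.trans_lt hi⟩, hj, by rw [hσ, fillFun_of_isRecord hrec, heq]⟩
    · rw [runMax_of_le σ (not_lt.1 hi), hg.2.2.2 i (not_lt.1 hi)]

theorem MPoly_eq_sum_ballotSet (n : ℕ) : MPoly n = ∑ g ∈ ballotSet n, dropWeight 0 n g := by
  refine Finset.sum_bij (fun σ _ => runMax σ) (fun σ _ => mem_ballotSet.2 (isBallot_runMax σ))
    (fun σ hσ τ hτ h => eq_of_runMax_eq hσ hτ h) (fun g hg => ?_)
    (fun σ hσ => weight_eq_dropWeight hσ)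
  obtain ⟨σ, hσ, h⟩ := exists_runMax_eq (mem_ballotSet.1 hg)
  exact ⟨σ, hσ, h⟩

theorem subT_dropWeight (k n : ℕ) (g : ℕ → ℕ) :
    subT k (dropWeight 0 n g) = dropWeight k n g := by
  classical
  rw [subT, dropWeight, dropWeight, map_prod]
  refine Finset.prod_congr rfl fun i _ => ?_
  split_ifs
  · simp only [map_mul, map_pow, bind₁_X_right, if_true, one_ne_zero, if_false]
    ring
  · exact map_one _

theorem subT_MPoly (k n : ℕ) : subT k (MPoly n) = ∑ g ∈ ballotSet n, dropWeight k n g := by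
  rw [MPoly_eq_sum_ballotSet]
  simp_rw [← subT_dropWeight k]
  exact map_sum _ _ _

open Classical in
/-- The ballot functions of size `n` that have no return before the end. -/
noncomputable def primeSet (n : ℕ) : Finset (ℕ → ℕ) :=
  (ballotSet n).filter fun g => ∀ i, i + 1 < n → i < g i

/-- Concatenation of a path of semilength `k` with another path. -/
def glue (k : ℕ) (p : (ℕ → ℕ) × (ℕ → ℕ)) (i : ℕ) : ℕ :=
  if i < k then p.1 i else p.2 (i - k) + k

theorem mem_primeSet {n : ℕ} {g : ℕ → ℕ} :
    g ∈ primeSet n ↔ IsBallot n g ∧ ∀ i, i + 1 < n → i < g i := by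
  simp [primeSet, mem_ballotSet]

theorem isBallot_glue {k m : ℕ} {g h : ℕ → ℕ} (hg : IsBallot k g) (hh : IsBallot m h) :
    IsBallot (k + m) (glue k (g, h)) := by
  obtain ⟨g1, g2, g3, g4⟩ := hg
  obtain ⟨h1, h2, h3, h4⟩ := hh
  refine ⟨fun a b hab => ?_, fun i => ?_, fun i hi => ?_, fun i hi => ?_⟩ <;>
    simp only [glue]
  · have := g1 hab
    have := h1 (Nat.sub_le_sub_right hab k)
    have := g3 a
    split_ifs <;> omega
  · have := g2 i
    have := h2 (i - k)
    split_ifs <;> omega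
  · have := g3 i
    have := h3 (i - k)
    split_ifs <;> omega
  · have := h4 (i - k)
    split_ifs <;> omega

theorem isDrop_glue_left {k : ℕ} {g h : ℕ → ℕ} (hg : IsBallot k g) {i : ℕ}
    (hi : i < k) : IsDrop (glue k (g, h)) i ↔ IsDrop g i := by
  have hrec : IsRecord (glue k (g, h)) i ↔ IsRecord g i := by
    refine forall₂_congr fun j hj => ?_
    simp only [glue, if_pos hi, if_pos (hj.trans hi)]
  have hstep : glue k (g, h) (i + 1) = glue k (g, h) i ↔ g (i + 1) = g i := by
    have h1 := hg.2.2.1 i hi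
    have h2 := hg.2.2.2 (i + 1)
    simp only [glue, if_pos hi]
    split_ifs <;> omega
  rw [IsDrop, IsDrop, hrec, hstep]

theorem isDrop_glue_right {k : ℕ} {g h : ℕ → ℕ} (hg : IsBallot k g) (i : ℕ) :
    IsDrop (glue k (g, h)) (k + i) ↔ IsDrop h i := by
  have hval : ∀ j, glue k (g, h) (k + j) = h j + k := fun j => by simp [glue]
  have hrec : IsRecord (glue k (g, h)) (k + i) ↔ IsRecord h i := by
    constructor
    · intro H j hj
      have := H (k + j) (by omega)
      rw [hval, hval] at this
      omega
    · intro H j hj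
      rw [hval]
      by_cases hjk : j < k
      · have := hg.2.2.1 j hjk
        simp only [glue, if_pos hjk]
        omega
      · have := H (j - k) (by omega)
        simp only [glue, if_neg hjk]
        omega
  rw [IsDrop, IsDrop, hrec, add_assoc, hval, hval, Nat.add_right_cancel_iff]

theorem dropWeight_glue {k m : ℕ} {g h : ℕ → ℕ} (hg : IsBallot k g) :
    dropWeight 0 (k + m) (glue k (g, h)) = dropWeight 0 k g * dropWeight k m h := by
  classical
  rw [dropWeight, Finset.prod_range_add, dropWeight, dropWeight]
  congr 1
  · refine Finset.prod_congr rfl fun i hi => ?_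
    simp only [isDrop_glue_left hg (mem_range.1 hi)]
  · refine Finset.prod_congr rfl fun i _ => ?_
    simp only [isDrop_glue_right hg, zero_add]

theorem exists_eq_glue {n : ℕ} (hn : 1 ≤ n) {f : ℕ → ℕ} (hf : IsBallot n f) :
    ∃ k < n, ∃ g ∈ ballotSet k, ∃ h ∈ primeSet (n - k), glue k (g, h) = f := by
  classical
  obtain ⟨h1, h2, h3, h4⟩ := hf
  let P : ℕ → Prop := fun k => ∀ i < k, f i < k
  have hP0 : P 0 := fun i hi => absurd hi (Nat.not_lt_zero _)
  set k := Nat.findGreatest P (n - 1) with hk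
  have hkP : P k := Nat.findGreatest_spec (Nat.zero_le _) hP0
  have hkn : k ≤ n - 1 := Nat.findGreatest_le _
  have hmax : ∀ l, k < l → l ≤ n - 1 → ¬ P l := fun l hl hl' =>
    Nat.findGreatest_is_greatest hl hl'
  refine ⟨k, by omega, fun i => if i < k then f i else i, ?_, fun i => f (k + i) - k, ?_, ?_⟩
  · rw [mem_ballotSet]
    refine ⟨fun a b hab => ?_, fun i => ?_, fun i hi => ?_, fun i hi => ?_⟩
    · have := h1 hab
      have := hkP a
      dsimp only
      split_ifs <;> omega
    · have := h2 i
      dsimp only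
      split_ifs <;> omega
    · have := hkP i hi
      simpa [hi] using this
    · simp [not_lt.2 hi]
  · rw [mem_primeSet]
    refine ⟨⟨fun a b hab => ?_, fun i => ?_, fun i hi => ?_, fun i hi => ?_⟩, fun i hi => ?_⟩
    · exact Nat.sub_le_sub_right (h1 (by omega)) k
    · dsimp only
      have := h2 (k + i)
      omega
    · dsimp only
      have := h3 (k + i) (by omega)
      omega
    · dsimp only
      have := h4 (k + i) (by omega)
      omega
    · by_contra hc
      have h5 := h2 (k + i)
      refine hmax (k + i + 1) (by omega) (by omega) fun j hj => ?_
      have := h1 (show j ≤ k + i by omega)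
      omega
  · funext i
    simp only [glue]
    split_ifs with hi
    · rfl
    · have := h2 i
      rw [show k + (i - k) = i by omega]
      omega

theorem glue_inj {n k k' : ℕ} (hk : k < n) (hk' : k' < n) {g h g' h' : ℕ → ℕ}
    (hg : IsBallot k g) (hg' : IsBallot k' g') (hh : h ∈ primeSet (n - k))
    (hh' : h' ∈ primeSet (n - k')) (heq : glue k (g, h) = glue k' (g', h')) :
    k = k' ∧ g = g' ∧ h = h' := by
  have key : ∀ {k k' : ℕ} {g h g' h' : ℕ → ℕ}, k' < n → IsBallot k' g' → h ∈ primeSet (n - k) →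
      glue k (g, h) = glue k' (g', h') → k' ≤ k := by
    intro k k' g h g' h' hk' hg' hh heq
    by_contra! hlt
    have h1 := congrFun heq (k' - 1)
    have h2 := hg'.2.2.1 (k' - 1) (by omega)
    have h3 := (mem_primeSet.1 hh).2 (k' - 1 - k) (by omega)
    simp only [glue] at h1
    rw [if_neg (by omega), if_pos (by omega)] at h1
    omega
  obtain rfl : k = k' := le_antisymm (key hk hg hh' heq.symm) (key hk' hg' hh heq)
  refine ⟨rfl, funext fun i => ?_, funext fun i => ?_⟩
  · by_cases hi : i < k
    · simpa [glue, hi] using congrFun heq i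
    · rw [hg.2.2.2 i (by omega), hg'.2.2.2 i (by omega)]
  · simpa [glue] using congrFun heq (k + i)

theorem MPoly_eq_sum_primeSet {n : ℕ} (hn : 1 ≤ n) :
    MPoly n = ∑ k ∈ range n, MPoly k * ∑ h ∈ primeSet (n - k), dropWeight k (n - k) h := by
  simp_rw [MPoly_eq_sum_ballotSet, Finset.sum_mul_sum, ← Finset.sum_product']
  rw [Finset.sum_sigma']
  symm
  refine Finset.sum_bij (fun x _ => glue x.1 x.2) ?_ ?_ ?_ ?_
  · rintro ⟨k, g, h⟩ hx
    simp only [mem_sigma, mem_range, mem_product, mem_ballotSet, mem_primeSet] at hx ⊢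
    have := isBallot_glue hx.2.1 hx.2.2.1
    rwa [show k + (n - k) = n by omega] at this
  · rintro ⟨k, g, h⟩ hx ⟨k', g', h'⟩ hx' heq
    simp only [mem_sigma, mem_range, mem_product, mem_ballotSet] at hx hx' heq
    obtain ⟨rfl, rfl, rfl⟩ := glue_inj hx.1 hx'.1 hx.2.1 hx'.2.1 hx.2.2 hx'.2.2 heq
    rfl
  · intro f hf
    obtain ⟨k, hk, g, hg, h, hh, rfl⟩ := exists_eq_glue hn (mem_ballotSet.1 hf)
    exact ⟨⟨k, g, h⟩, by simp [hk, hg, hh], rfl⟩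
  · rintro ⟨k, g, h⟩ hx
    simp only [mem_sigma, mem_range, mem_product, mem_ballotSet] at hx ⊢
    rw [← dropWeight_glue hx.2.1, show k + (n - k) = n by omega]

/-- The path `U B D` obtained from a path `B` of semilength `m`. -/
def lift (m : ℕ) (g : ℕ → ℕ) (i : ℕ) : ℕ := if i < m then g i + 1 else i

theorem lift_mem_primeSet {m : ℕ} {g : ℕ → ℕ} (hg : IsBallot m g) :
    lift m g ∈ primeSet (m + 1) := by
  obtain ⟨h1, h2, h3, h4⟩ := hg
  rw [mem_primeSet]
  refine ⟨⟨fun a b hab => ?_, fun i => ?_, fun i hi => ?_, fun i hi => ?_⟩, fun i hi => ?_⟩ <;>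
    simp only [lift]
  · have := h1 hab
    have := h3 a
    split_ifs <;> omega
  · have := h2 i
    split_ifs <;> omega
  · have := h3 i
    split_ifs <;> omega
  · split_ifs <;> omega
  · have := h2 i
    split_ifs <;> omega

theorem exists_lift_eq {m : ℕ} {f : ℕ → ℕ} (hf : f ∈ primeSet (m + 1)) :
    ∃ g ∈ ballotSet m, lift m g = f := by
  obtain ⟨⟨h1, h2, h3, h4⟩, h5⟩ := mem_primeSet.1 hf
  refine ⟨fun i => if i < m then f i - 1 else i, ?_, funext fun i => ?_⟩
  · rw [mem_ballotSet]
    refine ⟨fun a b hab => ?_, fun i => ?_, fun i hi => ?_, fun i hi => ?_⟩ <;> dsimp only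
    · have := h1 hab
      have := h3 a
      split_ifs <;> omega
    · have := h5 i
      split_ifs <;> omega
    · have := h3 i
      have := h5 i
      split_ifs
      omega
    · split_ifs <;> omega
  · have := h5 i
    have := h2 i
    have := h3 i
    have := h4 i
    simp only [lift]
    split_ifs <;> omega

open Classical in
theorem dropWeight_lift (k : ℕ) {m : ℕ} {g : ℕ → ℕ} (hg : IsBallot (m + 1) g) :
    dropWeight k (m + 2) (lift (m + 1) g) =
      dropWeight k (m + 1) g * if IsRecord g m then X 0 ^ (k + m + 1) * X 1 else 1 := by
  obtain ⟨h1, h2, h3, h4⟩ := hg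
  have hm : g m = m := le_antisymm (Nat.lt_succ_iff.1 (h3 m (by omega))) (h2 m)
  have hrec : ∀ i ≤ m, IsRecord (lift (m + 1) g) i ↔ IsRecord g i := fun i hi => by
    refine forall₂_congr fun j hj => ?_
    simp only [lift, if_pos (show i < m + 1 by omega), if_pos (show j < m + 1 by omega)]
    omega
  have hlast : ¬ IsDrop (lift (m + 1) g) (m + 1) := fun h => by
    have := h.1 m (by omega)
    simp [lift, hm] at this
  have hpen : IsDrop (lift (m + 1) g) m ↔ IsRecord g m := by
    rw [IsDrop, hrec m le_rfl, and_iff_left]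
    simp [lift, hm]
  have hpen' : ¬ IsDrop g m := fun h => by
    have := h.2
    rw [hm, h4 (m + 1) le_rfl] at this
    omega
  simp only [dropWeight]
  rw [Finset.prod_range_succ, Finset.prod_range_succ, Finset.prod_range_succ, if_neg hlast,
    if_neg hpen', mul_one, mul_one]
  congr 1
  · refine Finset.prod_congr rfl fun i hi => ?_
    have hi := mem_range.1 hi
    have : IsDrop (lift (m + 1) g) i ↔ IsDrop g i := by
      rw [IsDrop, IsDrop, hrec i hi.le]
      simp only [lift, if_pos (show i < m + 1 by omega), if_pos (show i + 1 < m + 1 by omega),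
        Nat.add_right_cancel_iff]
    simp only [this]
  · simp only [hpen]

open Classical in
theorem filter_isRecord_ballotSet (m : ℕ) :
    (ballotSet (m + 1)).filter (fun g => IsRecord g m) = ballotSet m := by
  ext g
  simp only [mem_filter, mem_ballotSet]
  constructor
  · rintro ⟨⟨h1, h2, h3, h4⟩, hrec⟩
    have hm : g m = m := le_antisymm (Nat.lt_succ_iff.1 (h3 m (by omega))) (h2 m)
    refine ⟨h1, h2, fun i hi => hm ▸ hrec i hi, fun i hi => ?_⟩
    rcases hi.lt_or_eq with hi | rfl
    · exact h4 i hi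
    · exact hm
  · rintro ⟨h1, h2, h3, h4⟩
    refine ⟨⟨h1, h2, fun i hi => ?_, fun i hi => h4 i (by omega)⟩, fun j hj => ?_⟩
    · have := h3 i
      have := h4 i
      omega
    · rw [h4 m le_rfl]
      exact h3 j hj

theorem dropWeight_succ (k : ℕ) {m : ℕ} {g : ℕ → ℕ} (hg : IsBallot m g) :
    dropWeight k (m + 1) g = dropWeight k m g := by
  classical
  rw [dropWeight, Finset.prod_range_succ, if_neg, mul_one, dropWeight]
  intro h
  have := h.2
  rw [hg.2.2.2 m le_rfl, hg.2.2.2 (m + 1) (by omega)] at this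
  omega

theorem sum_primeSet (k m : ℕ) :
    ∑ h ∈ primeSet (m + 2), dropWeight k (m + 2) h =
      subT k (MPoly (m + 1)) + (X 0 ^ (k + m + 1) * X 1 - 1) * subT k (MPoly m) := by
  classical
  have hbij : ∑ h ∈ primeSet (m + 2), dropWeight k (m + 2) h =
      ∑ g ∈ ballotSet (m + 1), dropWeight k (m + 2) (lift (m + 1) g) := by
    symm
    refine Finset.sum_bij (fun g _ => lift (m + 1) g)
      (fun g hg => lift_mem_primeSet (mem_ballotSet.1 hg)) (fun g hg g' hg' h => ?_)
      (fun f hf => ?_) (fun _ _ => rfl)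
    · rw [mem_ballotSet] at hg hg'
      funext i
      by_cases hi : i < m + 1
      · simpa [lift, hi] using congrFun h i
      · rw [hg.2.2.2 i (by omega), hg'.2.2.2 i (by omega)]
    · obtain ⟨g, hg, h⟩ := exists_lift_eq hf
      exact ⟨g, hg, h⟩
  rw [hbij, subT_MPoly, subT_MPoly, ← filter_isRecord_ballotSet m, Finset.mul_sum,
    Finset.sum_filter, ← Finset.sum_add_distrib]
  refine Finset.sum_congr rfl fun g hg => ?_
  rw [dropWeight_lift k (mem_ballotSet.1 hg)]
  split_ifs with hrec
  · have hg' : g ∈ ballotSet m := by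
      rw [← filter_isRecord_ballotSet, mem_filter]
      exact ⟨hg, hrec⟩
    rw [dropWeight_succ k (mem_ballotSet.1 hg')]
    ring
  · rw [mul_one, add_zero]

theorem sum_primeSet_one (k : ℕ) : ∑ h ∈ primeSet 1, dropWeight k 1 h = 1 := by
  have hset : primeSet 1 = {id} := by
    ext g
    rw [mem_primeSet, mem_singleton]
    constructor
    · rintro ⟨⟨-, -, h3, h4⟩, -⟩
      funext i
      have := h3 i
      have := h4 i
      simp only [id]
      by_cases hi : i < 1 <;> omega
    · rintro rfl
      exact ⟨⟨monotone_id, fun _ => le_rfl, fun _ hi => hi, fun _ _ => rfl⟩,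
        fun i hi => by omega⟩
  rw [hset, Finset.sum_singleton]
  simp [dropWeight, IsDrop]

/-- for n ≥ 1,
`M_n(q,t) = M_{n-1}(q,t) + Σ_{k=0}^{n-2} M_k(q,t)·[M_{n-k-1}(q,q^k t) + (q^{n-1}t - 1)M_{n-k-2}(q,q^k t)]`. -/
theorem stmt11 (n : ℕ) (hn : 1 ≤ n) :
    MPoly n = MPoly (n - 1) +
      ∑ k ∈ Finset.range (n - 1),
        MPoly k * (subT k (MPoly (n - k - 1)) +
          (X 0 ^ (n - 1) * X 1 - 1) * subT k (MPoly (n - k - 2))) := by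
  obtain ⟨n, rfl⟩ := Nat.exists_eq_add_of_le' hn
  rw [MPoly_eq_sum_primeSet hn, Finset.sum_range_succ, Nat.add_sub_cancel, Nat.add_sub_cancel_left,
    sum_primeSet_one, mul_one, add_comm]
  congr 1
  refine Finset.sum_congr rfl fun k hk => ?_
  obtain ⟨m, rfl⟩ := Nat.exists_eq_add_of_lt (mem_range.1 hk)
  rw [show k + m + 1 + 1 - k = m + 2 by omega, sum_primeSet]
  rfl
end

section
/- For every integer n ≥ 1, I_n(q,t,x) = t·x·I_{n-1}(q,t,x) + Σ_{k=0}^{n-2} q^{k+1} I_k(q,t,1)·[I_{n-1-k}(q,t,x) − t(x−1)·I_{n-2-k}(q,t,x)], as an identity in ℤ[q,t,x], where I_m(q,t,1) denotes I_m(q,t,x) with x replaced by 1. -/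
open Finset MvPolynomial

section LatticeWords

variable {n : ℕ}

/-- The height increment of a letter `(a, b)`: `a` opens a strand and `b` closes one. -/
def letterStep (p : Bool × Bool) : ℤ := (if p.1 then 1 else 0) - (if p.2 then 1 else 0)

/-- The height of a word after its first `i` letters. -/
def wordHeight (w : Fin n → Bool × Bool) (i : ℕ) : ℤ :=
  ∑ j : Fin n, if (j : ℕ) < i then letterStep (w j) else 0

/-- The weight of the letter `p` read at height `h`. -/
def letterWeight {R : Type*} [CommRing R] (q t x : R) (h : ℤ) (p : Bool × Bool) : R :=
  q ^ h.toNat * (if p.1 then t else if h ≤ 0 then 0 else 1) *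
    (if h = 0 ∧ p.1 ∧ p.2 then x else 1)

/-- The weight of the word `w` read from height `h`; it vanishes unless `w` ends at height `0`. -/
def wordWeight {R : Type*} [CommRing R] (q t x : R) (h : ℤ) (w : Fin n → Bool × Bool) : R :=
  (if h + wordHeight w n = 0 then 1 else 0) *
    ∏ i : Fin n, letterWeight q t x (h + wordHeight w i) (w i)

/-- The total weight of the words of length `n` read from height `h`. -/
def wordSum {R : Type*} [CommRing R] (q t x : R) (n : ℕ) (h : ℤ) : R :=
  ∑ w : Fin n → Bool × Bool, wordWeight q t x h w

lemma wordHeight_zero (w : Fin n → Bool × Bool) : wordHeight w 0 = 0 := by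
  simp [wordHeight]

lemma wordHeight_cons (p : Bool × Bool) (w : Fin n → Bool × Bool) (i : ℕ) :
    wordHeight (Fin.cons p w : Fin (n + 1) → Bool × Bool) (i + 1) =
      letterStep p + wordHeight w i := by
  simp [wordHeight, Fin.sum_univ_succ]

lemma wordHeight_succ (w : Fin n → Bool × Bool) (i : Fin n) :
    wordHeight w (i + 1) = wordHeight w i + letterStep (w i) := by
  have hi : letterStep (w i) = ∑ j : Fin n, if j = i then letterStep (w j) else 0 := by simp
  rw [hi, wordHeight, wordHeight, ← sum_add_distrib]
  refine sum_congr rfl fun j _ => ?_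
  rcases lt_trichotomy j i with h | rfl | h
  · have : (j : ℕ) < i := h
    simp [h.ne, this, this.trans (Nat.lt_succ_self _)]
  · simp
  · have : (i : ℕ) < j := h
    simp [h.ne', show ¬ (j : ℕ) < i + 1 by omega, show ¬ (j : ℕ) < i by omega]

section Recurrences

variable {R : Type*} [CommRing R] (q t x : R)

lemma wordWeight_cons (h : ℤ) (p : Bool × Bool) (w : Fin n → Bool × Bool) :
    wordWeight q t x h (Fin.cons p w : Fin (n + 1) → Bool × Bool) =
      letterWeight q t x h p * wordWeight q t x (h + letterStep p) w := by
  simp only [wordWeight, Fin.prod_univ_succ, wordHeight_cons, Fin.cons_zero, Fin.cons_succ,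
    Fin.val_zero, Fin.val_succ, wordHeight_zero, add_zero, add_assoc]
  ring

lemma wordSum_succ (n : ℕ) (h : ℤ) :
    wordSum q t x (n + 1) h =
      ∑ p : Bool × Bool, letterWeight q t x h p * wordSum q t x n (h + letterStep p) := by
  rw [wordSum, ← (Fin.consEquiv fun _ => Bool × Bool).sum_comp, Fintype.sum_prod_type]
  refine sum_congr rfl fun p _ => ?_
  rw [wordSum, mul_sum]
  exact sum_congr rfl fun w _ => wordWeight_cons q t x h p w

lemma wordSum_zero (h : ℤ) : wordSum q t x 0 h = if h = 0 then 1 else 0 := by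
  simp [wordSum, wordWeight, wordHeight]

lemma wordSum_succ_zero (n : ℕ) :
    wordSum q t x (n + 1) 0 = t * x * wordSum q t x n 0 + t * wordSum q t x n 1 := by
  simp [wordSum_succ, Fintype.sum_prod_type, letterWeight, letterStep]

lemma wordSum_succ_pos (n h : ℕ) :
    wordSum q t x (n + 1) (h + 1) = q ^ (h + 1) *
      (t * wordSum q t x n (h + 2) + (t + 1) * wordSum q t x n (h + 1) +
        wordSum q t x n h) := by
  have h0 : (h : ℤ) + 1 ≠ 0 := by omega
  have h1 : ¬ (h : ℤ) + 1 ≤ 0 := by omega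
  have h2 : ((h : ℤ) + 1).toNat = h + 1 := by omega
  simp [wordSum_succ, Fintype.sum_prod_type, letterWeight, letterStep, h0, h1, h2, add_assoc,
    show (1 : ℤ) + 1 = 2 from rfl]
  ring

/-- Decomposition of the words read from height `h + 1` at the first letter that closes the
strand opened last. -/
lemma mul_wordSum_succ_height (c : ℕ → R)
    (hc : ∀ m, c m = wordSum q t x (m + 1) 0 - t * (x - 1) * wordSum q t x m 0) (n h : ℕ) :
    t * wordSum q t x n (h + 1) =
      ∑ k ∈ range n, q ^ (k + 1) * wordSum q t 1 k h * c (n - 1 - k) := by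
  induction n generalizing h with
  | zero => simp [wordSum_zero, show (h : ℤ) + 1 ≠ 0 by omega]
  | succ n ih =>
    rw [sum_range_succ', wordSum_succ_pos]
    have hsub : ∀ k, n + 1 - 1 - (k + 1) = n - 1 - k := fun k => by omega
    simp only [hsub]
    simp only [Nat.add_sub_cancel, Nat.sub_zero, wordSum_zero]
    rcases h with _ | h
    · have h0 := ih 0
      have h1 := ih 1
      simp only [Nat.cast_zero, Nat.cast_one, zero_add, one_add_one_eq_two] at h0 h1 ⊢
      have key : ∀ k, q ^ (k + 1 + 1) * wordSum q t 1 (k + 1) 0 * c (n - 1 - k) =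
          q * t * (q ^ (k + 1) * wordSum q t 1 k 0 * c (n - 1 - k)) +
          q * t * (q ^ (k + 1) * wordSum q t 1 k 1 * c (n - 1 - k)) := fun k => by
        rw [wordSum_succ_zero]; ring
      simp only [key, sum_add_distrib, ← mul_sum, ← h0, ← h1, if_true]
      rw [hc, wordSum_succ_zero q t x]
      ring
    · have h0 := ih h
      have h1 := ih (h + 1)
      have h2 := ih (h + 2)
      push_cast at h0 h1 h2 ⊢
      rw [if_neg (by omega)]
      rw [show (h : ℤ) + 2 + 1 = h + 1 + 2 by ring] at h2
      have key : ∀ k, q ^ (k + 1 + 1) * wordSum q t 1 (k + 1) (h + 1) * c (n - 1 - k) =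
          q ^ (h + 2) * t * (q ^ (k + 1) * wordSum q t 1 k (h + 2) * c (n - 1 - k)) +
          q ^ (h + 2) * (t + 1) * (q ^ (k + 1) * wordSum q t 1 k (h + 1) * c (n - 1 - k)) +
          q ^ (h + 2) * (q ^ (k + 1) * wordSum q t 1 k h * c (n - 1 - k)) := fun k => by
        rw [wordSum_succ_pos]; ring
      simp only [key, sum_add_distrib, ← mul_sum, ← h0, ← h1, ← h2]
      ring

end Recurrences

end LatticeWords

section Permutations

variable {n : ℕ} {σ : Equiv.Perm (Fin n)}

/-- The word of a permutation: the letter `i` records whether the position `i` carries a value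
at least `i` and whether the value `i` sits at a position at most `i`. -/
def permWord (σ : Equiv.Perm (Fin n)) (i : Fin n) : Bool × Bool :=
  (decide (i ≤ σ i), decide (σ.symm i ≤ i))

lemma exists_up_crossing (σ : Equiv.Perm (Fin n)) {i k : Fin n} (hk : i ≤ k) (hσ : σ k < i) :
    ∃ j, j < i ∧ i ≤ σ j := by
  by_contra! h
  have himg : (Iio i).image σ = Iio i := by
    refine eq_of_subset_of_card_le (fun m hm => ?_) ?_
    · obtain ⟨j, hj, rfl⟩ := mem_image.1 hm
      exact mem_Iio.2 (h j (mem_Iio.1 hj))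
    · rw [card_image_of_injective _ σ.injective]
  obtain ⟨j, hj, hjk⟩ := mem_image.1 (himg.symm ▸ mem_Iio.2 hσ : σ k ∈ (Iio i).image σ)
  exact absurd (σ.injective hjk ▸ mem_Iio.1 hj) hk.not_gt

lemma exists_down_crossing (σ : Equiv.Perm (Fin n)) {i j : Fin n} (hj : j < i) (hσ : i ≤ σ j) :
    ∃ k, i ≤ k ∧ σ k < i := by
  obtain ⟨m, hm, hm'⟩ := exists_up_crossing σ.symm (k := σ j) hσ (by simpa using hj)
  exact ⟨σ.symm m, hm', by simpa using hm⟩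

lemma Avoids321.isLRMax_iff (hσ : Avoids321 σ) (i : Fin n) : IsLRMax σ i ↔ i ≤ σ i := by
  constructor
  · intro h
    by_contra! hi
    obtain ⟨j, hj, hj'⟩ := exists_up_crossing σ le_rfl hi
    exact absurd (h j hj.le) (hi.trans_le hj').not_ge
  · intro h j hj
    by_contra! hlt
    have hji : j < i := lt_of_le_of_ne hj (by rintro rfl; exact lt_irrefl _ hlt)
    obtain ⟨k, hk, hk'⟩ := exists_down_crossing σ (hji.trans_le h) hlt.le
    have hik : i < k := lt_of_le_of_ne (h.trans hk) (by rintro rfl; exact lt_irrefl _ hk')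
    exact hσ ⟨j, i, k, hji, hik, hk', hlt⟩

lemma Avoids321.lt_of_le_apply (hσ : Avoids321 σ) {i j : Fin n} (hij : i < j) (hj : j ≤ σ j) :
    σ i < σ j :=
  lt_of_le_of_ne ((hσ.isLRMax_iff j).2 hj i hij.le) (σ.injective.ne hij.ne)

lemma Avoids321.lt_of_apply_lt (hσ : Avoids321 σ) {i j : Fin n} (hij : i < j) (hi : σ i < i) :
    σ i < σ j := by
  by_contra! h
  obtain ⟨k, hk, hk'⟩ := exists_up_crossing σ le_rfl hi
  exact hσ ⟨k, i, j, hk, hij, lt_of_le_of_ne h (σ.injective.ne hij.ne'), hi.trans_le hk'⟩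

lemma Avoids321.card_inversions_from (hσ : Avoids321 σ) (i : Fin n) :
    #{k | i < k ∧ σ k < σ i} = (σ i : ℕ) - i := by
  by_cases hi : i ≤ σ i
  · have hval : #{k | σ k < σ i} = (σ i : ℕ) := by
      have : ({k | σ k < σ i} : Finset (Fin n)) = (Iio (σ i)).map σ.symm.toEmbedding := by
        ext k; simp
      rw [this, card_map, Fin.card_Iio]
    have hsplit : ({k | σ k < σ i} : Finset (Fin n)) =
        Iio i ∪ ({k | i < k ∧ σ k < σ i} : Finset (Fin n)) := by
      ext k
      simp only [mem_filter, mem_univ, true_and, mem_union, mem_Iio]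
      constructor
      · intro hk
        rcases lt_trichotomy k i with h | rfl | h
        · exact Or.inl h
        · exact absurd hk (lt_irrefl _)
        · exact Or.inr ⟨h, hk⟩
      · rintro (h | h)
        · exact hσ.lt_of_le_apply h hi
        · exact h.2
    have hdisj : Disjoint (Iio i) ({k | i < k ∧ σ k < σ i} : Finset (Fin n)) := by
      rw [disjoint_left]
      intro k hk hk'
      exact lt_asymm (mem_Iio.1 hk) (mem_filter.1 hk').2.1
    rw [hsplit, card_union_of_disjoint hdisj, Fin.card_Iio] at hval
    omega
  · have hi' : (σ i : ℕ) < i := not_le.1 hi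
    rw [Nat.sub_eq_zero_of_le hi'.le, card_eq_zero, filter_eq_empty_iff]
    rintro k - ⟨hik, hk⟩
    exact lt_asymm hk (hσ.lt_of_apply_lt hik (not_le.1 hi))

lemma Avoids321.invPerm_eq (hσ : Avoids321 σ) : invPerm σ = ∑ i, ((σ i : ℕ) - i) := by
  simp_rw [← hσ.card_inversions_from, invPerm, card_filter, Fintype.sum_prod_type]

lemma sum_card_crossings (σ : Equiv.Perm (Fin n)) :
    ∑ i : Fin n, #{j | j < i ∧ i ≤ σ j} = ∑ i, ((σ i : ℕ) - i) := by
  simp_rw [card_filter]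
  rw [sum_comm]
  refine sum_congr rfl fun j _ => ?_
  rw [← card_filter, ← Fin.card_Ioc]
  congr 1
  ext i
  simp

lemma wordHeight_permWord (σ : Equiv.Perm (Fin n)) (i : ℕ) :
    wordHeight (permWord σ) i = #{j : Fin n | (j : ℕ) < i ∧ i ≤ σ j} := by
  have hreindex : ∑ j : Fin n, (if (j : ℕ) < i then if σ.symm j ≤ j then (1 : ℤ) else 0 else 0) =
      ∑ j : Fin n, if (σ j : ℕ) < i then if j ≤ σ j then (1 : ℤ) else 0 else 0 := by
    rw [← Equiv.sum_comp σ]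
    simp
  have hsplit : wordHeight (permWord σ) i =
      ∑ j : Fin n, (if (j : ℕ) < i then if j ≤ σ j then (1 : ℤ) else 0 else 0) -
        ∑ j : Fin n, (if (j : ℕ) < i then if σ.symm j ≤ j then (1 : ℤ) else 0 else 0) := by
    rw [← sum_sub_distrib]
    refine sum_congr rfl fun j _ => ?_
    by_cases h : (j : ℕ) < i <;> simp [letterStep, permWord, h]
  rw [hsplit, hreindex, ← sum_sub_distrib, card_filter]
  push_cast
  refine sum_congr rfl fun j _ => ?_
  simp only [Fin.le_def]
  split_ifs <;> omega

lemma wordHeight_permWord_length (σ : Equiv.Perm (Fin n)) : wordHeight (permWord σ) n = 0 := by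
  rw [wordHeight_permWord, Nat.cast_eq_zero, card_eq_zero, filter_eq_empty_iff]
  rintro j - ⟨-, h⟩
  exact absurd (σ j).isLt h.not_gt

lemma Avoids321.crossings_eq_zero_and_iff (hσ : Avoids321 σ) (i : Fin n) :
    (#{j | j < i ∧ i ≤ σ j} = 0 ∧ i ≤ σ i ∧ σ.symm i ≤ i) ↔ σ i = i := by
  rw [card_eq_zero, filter_eq_empty_iff]
  constructor
  · rintro ⟨h, -, h2⟩
    rcases h2.lt_or_eq with h2 | h2
    · exact absurd ⟨h2, by simp⟩ (h (mem_univ (σ.symm i)))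
    · exact ((Equiv.symm_apply_eq σ).1 h2).symm
  · intro h
    refine ⟨?_, h.ge, ((Equiv.symm_apply_eq σ).2 h.symm).le⟩
    rintro j - ⟨hj, hj'⟩
    exact absurd (hσ.lt_of_le_apply hj h.ge) (h.trans_le hj').not_gt

section Weights

variable {R : Type*} [CommRing R] (q t x : R)

lemma Avoids321.letterWeight_permWord (hσ : Avoids321 σ) (i : Fin n) :
    letterWeight q t x (wordHeight (permWord σ) i) (permWord σ i) =
      q ^ #{j | j < i ∧ i ≤ σ j} * (if i ≤ σ i then t else 1) * (if σ i = i then x else 1) := by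
  have hh : wordHeight (permWord σ) i = #{j | j < i ∧ i ≤ σ j} := wordHeight_permWord σ i
  rw [hh, letterWeight, Int.toNat_natCast]
  congr 1
  · congr 1
    by_cases hi : i ≤ σ i
    · simp [permWord, hi]
    · obtain ⟨j, hj⟩ := exists_up_crossing σ le_rfl (not_le.1 hi)
      have hpos : 0 < #{j | j < i ∧ i ≤ σ j} := card_pos.2 ⟨j, by simpa using hj⟩
      rw [if_neg (by simpa [permWord] using hi), if_neg (by omega), if_neg hi]
  · refine if_congr ?_ rfl rfl
    rw [← hσ.crossings_eq_zero_and_iff i]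
    simp only [permWord, decide_eq_true_eq, Nat.cast_eq_zero]

lemma Avoids321.wordWeight_permWord (hσ : Avoids321 σ) :
    wordWeight q t x 0 (permWord σ) = q ^ invPerm σ * t ^ lrm σ * x ^ fixPerm σ := by
  simp only [wordWeight, zero_add, wordHeight_permWord_length, if_true, one_mul,
    hσ.letterWeight_permWord, prod_mul_distrib, prod_pow_eq_pow_sum, sum_card_crossings,
    ← hσ.invPerm_eq, prod_ite, prod_const, one_pow, mul_one, lrm, fixPerm,
    hσ.isLRMax_iff]

end Weights

lemma Avoids321.apply_le_of_permWord_eq {σ τ : Equiv.Perm (Fin n)} (hτ : Avoids321 τ)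
    (h : permWord σ = permWord τ) {i : Fin n} (ih : ∀ j < i, σ j = τ j) : τ i ≤ σ i := by
  have hpos : ∀ j, j ≤ σ j ↔ j ≤ τ j := fun j => by
    simpa [permWord] using congrArg Prod.fst (congrFun h j)
  have hval : ∀ j, σ.symm j ≤ j ↔ τ.symm j ≤ j := fun j => by
    simpa [permWord] using congrArg Prod.snd (congrFun h j)
  obtain ⟨j, hj⟩ := τ.surjective (σ i)
  have hclass : i ≤ σ i ↔ j ≤ τ j := by
    have := hval (σ i)
    rw [Equiv.symm_apply_apply, ← hj, Equiv.symm_apply_apply] at this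
    rwa [hj] at this ⊢
  rcases lt_trichotomy j i with hji | rfl | hij
  · exact absurd (σ.injective ((ih j hji).trans hj)) hji.ne
  · exact hj.le
  · rw [← hj]
    by_cases hi : i ≤ σ i
    · exact (hτ.lt_of_le_apply hij (hclass.1 hi)).le
    · exact (hτ.lt_of_apply_lt hij (not_le.1 (mt (hpos i).2 hi))).le

lemma permWord_injOn : Set.InjOn permWord (Av n : Set (Equiv.Perm (Fin n))) := by
  intro σ hσ τ hτ h
  have hσ' : Avoids321 σ := by simpa [Av] using hσ
  have hτ' : Avoids321 τ := by simpa [Av] using hτ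
  ext i
  congr 1
  induction i using WellFoundedLT.induction with
  | ind i ih =>
    exact le_antisymm (hσ'.apply_le_of_permWord_eq h.symm fun j hj => (ih j hj).symm)
      (hτ'.apply_le_of_permWord_eq h ih)

lemma wordHeight_eq_card_true (w : Fin n → Bool × Bool) (i : ℕ) :
    wordHeight w i = (#{j : Fin n | (j : ℕ) < i ∧ (w j).1 = true} : ℤ) -
      #{j : Fin n | (j : ℕ) < i ∧ (w j).2 = true} := by
  rw [wordHeight, card_filter, card_filter]
  push_cast
  rw [← sum_sub_distrib]
  refine sum_congr rfl fun j _ => ?_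
  by_cases h : (j : ℕ) < i <;> simp [letterStep, h]

lemma wordHeight_eq_card_false (w : Fin n → Bool × Bool) (i : ℕ) :
    wordHeight w i = (#{j : Fin n | (j : ℕ) < i ∧ ¬ (w j).2 = true} : ℤ) -
      #{j : Fin n | (j : ℕ) < i ∧ ¬ (w j).1 = true} := by
  rw [wordHeight, card_filter, card_filter]
  push_cast
  rw [← sum_sub_distrib]
  refine sum_congr rfl fun j _ => ?_
  by_cases h : (j : ℕ) < i
  · rcases hw : w j with ⟨_ | _, _ | _⟩ <;> simp [letterStep, h]
  · simp [h]

lemma exists_perm_strictMonoOn {α : Type*} [Fintype α] [LinearOrder α] (p r : α → Prop)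
    [DecidablePred p] [DecidablePred r]
    (h : Fintype.card {i // p i} = Fintype.card {i // r i}) :
    ∃ σ : Equiv.Perm α, (∀ i, r (σ i) ↔ p i) ∧
      StrictMonoOn σ {i | p i} ∧ StrictMonoOn σ {i | ¬ p i} := by
  have h' : Fintype.card {i // ¬ p i} = Fintype.card {i // ¬ r i} := by
    rw [Fintype.card_subtype_compl, Fintype.card_subtype_compl, h]
  let e : {i // p i} ≃o {i // r i} := (monoEquivOfFin _ h).symm.trans (monoEquivOfFin _ rfl)
  let f : {i // ¬ p i} ≃o {i // ¬ r i} := (monoEquivOfFin _ h').symm.trans (monoEquivOfFin _ rfl)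
  have hpos : ∀ i (hi : p i), e.toEquiv.subtypeCongr f.toEquiv i = e ⟨i, hi⟩ := fun i hi => by
    simp [Equiv.subtypeCongr, hi]
  have hneg : ∀ i (hi : ¬ p i), e.toEquiv.subtypeCongr f.toEquiv i = f ⟨i, hi⟩ := fun i hi => by
    simp [Equiv.subtypeCongr, hi]
  refine ⟨e.toEquiv.subtypeCongr f.toEquiv, fun i => ?_, fun i hi j hj hij => ?_,
    fun i hi j hj hij => ?_⟩
  · by_cases hi : p i
    · simpa [hpos i hi, hi] using (e ⟨i, hi⟩).2
    · simpa [hneg i hi, hi] using (f ⟨i, hi⟩).2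
  · rw [hpos i hi, hpos j hj]
    exact e.strictMono (Subtype.mk_lt_mk.2 hij)
  · rw [hneg i hi, hneg j hj]
    exact f.strictMono (Subtype.mk_lt_mk.2 hij)

lemma exists_permWord_eq (w : Fin n → Bool × Bool) (hend : wordHeight w n = 0)
    (hnonneg : ∀ i : Fin n, 0 ≤ wordHeight w i)
    (hdown : ∀ i : Fin n, ¬ (w i).1 = true → 0 < wordHeight w i) :
    ∃ σ ∈ Av n, permWord σ = w := by
  have hcard : Fintype.card {i // (w i).1 = true} = Fintype.card {i // (w i).2 = true} := by
    rw [wordHeight_eq_card_true] at hend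
    simp only [Fin.is_lt, true_and] at hend
    rw [Fintype.card_subtype, Fintype.card_subtype]
    omega
  obtain ⟨σ, hval, hmono, hmono'⟩ := exists_perm_strictMonoOn _ _ hcard
  have hup : ∀ i, (w i).1 = true → i ≤ σ i := fun i hi => by
    by_contra! hlt
    have hss : (({j | j < i ∧ (w j).1 = true} : Finset (Fin n)).image σ) ⊂
        ({j | j < i ∧ (w j).2 = true} : Finset (Fin n)) := by
      refine Finset.ssubset_iff_subset_ne.2 ⟨?_, fun heq => ?_⟩
      · intro m hm
        obtain ⟨j, hj, rfl⟩ := mem_image.1 hm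
        simp only [mem_filter, mem_univ, true_and] at hj ⊢
        exact ⟨(hmono hj.2 hi hj.1).trans hlt, (hval j).2 hj.2⟩
      · have hmem : σ i ∈ ({j | j < i ∧ (w j).2 = true} : Finset (Fin n)) := by
          simpa using ⟨hlt, (hval i).2 hi⟩
        rw [← heq, mem_image] at hmem
        obtain ⟨j, hj, hji⟩ := hmem
        rw [σ.injective hji] at hj
        simp at hj
    have hlt' := card_lt_card hss
    rw [card_image_of_injective _ σ.injective] at hlt'
    have hi' := hnonneg i
    rw [wordHeight_eq_card_true] at hi'
    simp only [← Fin.lt_def] at hi'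
    omega
  have hlow : ∀ i, ¬ (w i).1 = true → σ i < i := fun i hi => by
    by_contra! hle
    have hsub : (({j | j < i ∧ ¬ (w j).2 = true} : Finset (Fin n)).image σ.symm) ⊆
        ({j | j < i ∧ ¬ (w j).1 = true} : Finset (Fin n)) := by
      intro m hm
      obtain ⟨j, hj, rfl⟩ := mem_image.1 hm
      simp only [mem_filter, mem_univ, true_and] at hj ⊢
      have hp : ¬ (w (σ.symm j)).1 = true := by
        rw [← hval, Equiv.apply_symm_apply]; exact hj.2
      refine ⟨(hmono'.lt_iff_lt hp hi).1 ?_, hp⟩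
      rw [Equiv.apply_symm_apply]
      exact hj.1.trans_le hle
    have hle' := card_le_card hsub
    rw [card_image_of_injective _ σ.symm.injective] at hle'
    have hi' := hdown i hi
    rw [wordHeight_eq_card_false] at hi'
    simp only [← Fin.lt_def] at hi'
    omega
  have hiff : ∀ i, i ≤ σ i ↔ (w i).1 = true := fun i =>
    ⟨fun h => by_contra fun hi => (hlow i hi).not_ge h, hup i⟩
  refine ⟨σ, ?_, funext fun i => Prod.ext ?_ ?_⟩
  · simp only [Av, mem_filter, mem_univ, true_and]
    rintro ⟨i, j, k, hij, hjk, hkj, hji⟩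
    by_cases hj : (w j).1 = true
    · by_cases hi : (w i).1 = true
      · exact lt_asymm hji (hmono hi hj hij)
      · exact lt_irrefl _ (((hup j hj).trans_lt hji).trans ((hlow i hi).trans hij))
    · by_cases hk : (w k).1 = true
      · exact lt_irrefl _ (((hup k hk).trans_lt hkj).trans ((hlow j hj).trans hjk))
      · exact lt_asymm hkj (hmono' hj hk hjk)
  · simp [permWord, hiff]
  · have h1 := hiff (σ.symm i)
    rw [Equiv.apply_symm_apply, ← hval, Equiv.apply_symm_apply] at h1
    simp [permWord, h1]

section Enumeration

variable {R : Type*} [CommRing R] (q t x : R)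

lemma exists_permWord_eq_of_wordWeight_ne_zero (w : Fin n → Bool × Bool)
    (hw : wordWeight q t x 0 w ≠ 0) : ∃ σ ∈ Av n, permWord σ = w := by
  simp only [wordWeight, zero_add] at hw
  have hend : wordHeight w n = 0 := by
    by_contra h
    simp [h] at hw
  have hdown : ∀ i : Fin n, ¬ (w i).1 = true → 0 < wordHeight w i := fun i hi => by
    by_contra! h
    refine hw (mul_eq_zero_of_right _ (prod_eq_zero (mem_univ i) ?_))
    simp [letterWeight, hi, h]
  have hnonneg : ∀ i : ℕ, i ≤ n → 0 ≤ wordHeight w i := fun i => by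
    induction i with
    | zero => simp [wordHeight_zero]
    | succ i ih =>
      intro hi
      have h0 := ih (by omega)
      have h1 := hdown ⟨i, hi⟩
      rw [wordHeight_succ w ⟨i, hi⟩, letterStep]
      simp only at h0 h1 ⊢
      split_ifs <;> grind
  exact exists_permWord_eq w hend (fun i => hnonneg i i.isLt.le) hdown

lemma sum_Av_eq_wordSum (n : ℕ) :
    ∑ σ ∈ Av n, q ^ invPerm σ * t ^ lrm σ * x ^ fixPerm σ = wordSum q t x n 0 := by
  refine sum_of_injOn permWord permWord_injOn (fun _ _ => mem_coe.2 (mem_univ _))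
    (fun w _ hw => ?_) fun σ hσ => ?_
  · by_contra h
    exact hw (exists_permWord_eq_of_wordWeight_ne_zero q t x w h)
  · exact (Avoids321.wordWeight_permWord q t x (mem_filter.1 hσ).2).symm

end Enumeration

end Permutations

lemma IPoly3_eq_wordSum (n : ℕ) : IPoly3 n = wordSum (X 0) (X 1) (X 2) n 0 :=
  sum_Av_eq_wordSum _ _ _ n

lemma subX1_IPoly3_eq_wordSum (n : ℕ) : subX1 (IPoly3 n) = wordSum (X 0) (X 1) 1 n 0 := by
  rw [← sum_Av_eq_wordSum]
  simp [subX1, IPoly3]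


/-- for n ≥ 1,
`I_n(q,t,x) = tx·I_{n-1}(q,t,x) + Σ_{k=0}^{n-2} q^{k+1} I_k(q,t,1)·[I_{n-1-k}(q,t,x) - t(x-1)·I_{n-2-k}(q,t,x)]`. -/
theorem stmt15 (n : ℕ) (hn : 1 ≤ n) :
    IPoly3 n = X 1 * X 2 * IPoly3 (n - 1) +
      ∑ k ∈ Finset.range (n - 1), X 0 ^ (k + 1) * subX1 (IPoly3 k) *
        (IPoly3 (n - 1 - k) - X 1 * (X 2 - 1) * IPoly3 (n - 2 - k)) := by
  obtain ⟨m, rfl⟩ : ∃ m, n = m + 1 := ⟨n - 1, by omega⟩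
  have h := mul_wordSum_succ_height (X 0 : MvPolynomial (Fin 3) ℤ) (X 1) (X 2)
    (fun m => wordSum (X 0) (X 1) (X 2) (m + 1) 0 -
      X 1 * (X 2 - 1) * wordSum (X 0) (X 1) (X 2) m 0) (fun _ => rfl) m 0
  simp only [Nat.cast_zero, zero_add] at h
  simp only [subX1_IPoly3_eq_wordSum]
  simp only [IPoly3_eq_wordSum, Nat.add_sub_cancel]
  rw [wordSum_succ_zero, h]
  rw [add_right_inj]
  refine sum_congr rfl fun k hk => ?_
  have hk' := mem_range.1 hk
  rw [show m - 1 - k + 1 = m - k by omega, show m + 1 - 2 - k = m - 1 - k by omega]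
end

section
/- For every integer n ≥ 1, Σ_{σ∈Av_n(321)} (−1)^{inv σ} t^{lrm σ} = Σ_{k=1}^{n} (−1)^{n−k}·binom(⌊(n−1)/2⌋, ⌊(k−1)/2⌋)·binom(⌈(n−1)/2⌉, ⌈(k−1)/2⌉)·t^{k}, as an identity in ℤ[t]. -/
open Finset MvPolynomial

/-- Append the value `v` to the word of `τ`, shifting the values `≥ v` up by one. -/
def appendValue {n : ℕ} (v : Fin (n + 1)) (τ : Equiv.Perm (Fin n)) : Equiv.Perm (Fin (n + 1)) :=
  (finSuccEquivLast.trans (Equiv.optionCongr τ)).trans (finSuccEquiv' v).symm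

@[simp] lemma appendValue_castSucc {n : ℕ} (v : Fin (n + 1)) (τ : Equiv.Perm (Fin n)) (i : Fin n) :
    appendValue v τ i.castSucc = v.succAbove (τ i) := by
  simp [appendValue]

@[simp] lemma appendValue_last {n : ℕ} (v : Fin (n + 1)) (τ : Equiv.Perm (Fin n)) :
    appendValue v τ (Fin.last n) = v := by
  simp [appendValue]

lemma appendValue_bijective (n : ℕ) :
    Function.Bijective
      (fun p : Equiv.Perm (Fin n) × Fin (n + 1) => appendValue p.2 p.1) := by
  rw [Fintype.bijective_iff_injective_and_card]
  refine ⟨?_, by simp [Fintype.card_perm, Nat.factorial_succ, mul_comm]⟩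
  rintro ⟨τ, v⟩ ⟨τ', v'⟩ h
  have hv : v = v' := by simpa using congrArg (fun σ => σ (Fin.last n)) h
  subst hv
  have hτ : τ = τ' := by
    ext1 i
    simpa using congrArg (fun σ => σ i.castSucc) h
  rw [hτ]

lemma isLRMax_appendValue_castSucc {n : ℕ} (v : Fin (n + 1)) (τ : Equiv.Perm (Fin n))
    (i : Fin n) : IsLRMax (appendValue v τ) i.castSucc ↔ IsLRMax τ i := by
  simp [IsLRMax, Fin.forall_fin_succ', Fin.succAbove_le_succAbove_iff, Fin.castSucc_lt_last,
    not_le.2]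

lemma isLRMax_appendValue_last {n : ℕ} (v : Fin (n + 1)) (τ : Equiv.Perm (Fin n)) :
    IsLRMax (appendValue v τ) (Fin.last n) ↔ v = Fin.last n := by
  constructor
  · intro h
    have := h ((appendValue v τ).symm (Fin.last n)) (Fin.le_last _)
    simpa using this
  · rintro rfl j -
    simpa using Fin.le_last _

/-- Positions which are not left-right maxima. -/
def nonLRMax {n : ℕ} (σ : Equiv.Perm (Fin n)) : Finset (Fin n) :=
  univ.filter (fun i => ¬ IsLRMax σ i)

lemma nonLRMax_appendValue {n : ℕ} (v : Fin (n + 1)) (τ : Equiv.Perm (Fin n)) :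
    nonLRMax (appendValue v τ) =
      if v = Fin.last n then (nonLRMax τ).map Fin.castSuccEmb
      else insert (Fin.last n) ((nonLRMax τ).map Fin.castSuccEmb) := by
  ext i
  split_ifs with h <;> induction i using Fin.lastCases <;>
    simp [nonLRMax, isLRMax_appendValue_castSucc, isLRMax_appendValue_last, h,
      Fin.castSucc_ne_last]

lemma lrm_add_card_nonLRMax {n : ℕ} (σ : Equiv.Perm (Fin n)) :
    lrm σ + (nonLRMax σ).card = n := by
  simpa [lrm, nonLRMax] using
    Finset.card_filter_add_card_filter_not (s := (univ : Finset (Fin n))) (IsLRMax σ)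

lemma card_nonLRMax_appendValue {n : ℕ} (v : Fin (n + 1)) (τ : Equiv.Perm (Fin n)) :
    (nonLRMax (appendValue v τ)).card =
      (nonLRMax τ).card + if v = Fin.last n then 0 else 1 := by
  rw [nonLRMax_appendValue]
  split_ifs with h
  · simp
  · rw [card_insert_of_notMem (by simp [Fin.castSucc_ne_last]), card_map]

/-- The smallest bound (as a natural number) strictly above all the values of `σ` which are not
left-right maxima. -/
def nonLRMaxBound {n : ℕ} (σ : Equiv.Perm (Fin n)) : ℕ :=
  (nonLRMax σ).sup fun i => (σ i).val + 1

lemma nonLRMaxBound_le_iff {n : ℕ} (σ : Equiv.Perm (Fin n)) (b : ℕ) :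
    nonLRMaxBound σ ≤ b ↔ ∀ i, ¬ IsLRMax σ i → (σ i).val < b := by
  simp [nonLRMaxBound, nonLRMax]

lemma nonLRMaxBound_le {n : ℕ} (σ : Equiv.Perm (Fin n)) : nonLRMaxBound σ ≤ n :=
  (nonLRMaxBound_le_iff σ n).2 fun i _ => (σ i).isLt

lemma val_succAbove_of_lt {n : ℕ} {v : Fin (n + 1)} {a : Fin n} (h : a.val < v.val) :
    (v.succAbove a).val = a.val := by
  rw [Fin.succAbove_of_castSucc_lt _ _ (by simpa [Fin.lt_def] using h)]
  rfl

lemma lt_succAbove_iff_not_val_lt {n : ℕ} (v : Fin (n + 1)) (a : Fin n) :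
    v < v.succAbove a ↔ ¬ a.val < v.val := by
  rw [Fin.lt_succAbove_iff_le_castSucc, Fin.le_def, not_lt, Fin.val_castSucc]

lemma avoids321_appendValue {n : ℕ} (v : Fin (n + 1)) (τ : Equiv.Perm (Fin n)) :
    Avoids321 (appendValue v τ) ↔ Avoids321 τ ∧ nonLRMaxBound τ ≤ v.val := by
  rw [nonLRMaxBound_le_iff]
  constructor
  · intro h
    refine ⟨?_, ?_⟩
    · rintro ⟨i, j, k, hij, hjk, h1, h2⟩
      exact h ⟨i.castSucc, j.castSucc, k.castSucc, by simpa, by simpa, by simpa, by simpa⟩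
    · intro j hj
      by_contra hv
      simp only [IsLRMax, not_forall, not_le] at hj
      obtain ⟨i, hij, hi⟩ := hj
      have hne : i ≠ j := by rintro rfl; exact lt_irrefl _ hi
      exact h ⟨i.castSucc, j.castSucc, Fin.last n, by simpa using lt_of_le_of_ne hij hne,
        Fin.castSucc_lt_last j, by simpa [lt_succAbove_iff_not_val_lt] using hv, by simpa⟩
  · rintro ⟨hτ, hb⟩ ⟨i, j, k, hij, hjk, h1, h2⟩
    obtain ⟨j, rfl⟩ := Fin.exists_castSucc_eq.2 (ne_of_lt (hjk.trans_le (Fin.le_last k)))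
    obtain ⟨i, rfl⟩ := Fin.exists_castSucc_eq.2 (ne_of_lt (hij.trans (Fin.castSucc_lt_last j)))
    have h2' : τ j < τ i := by simpa using h2
    have hij' : i < j := by simpa using hij
    induction k using Fin.lastCases with
    | last =>
      refine (lt_succAbove_iff_not_val_lt v (τ j)).1 (by simpa using h1) (hb j fun hj => ?_)
      exact absurd (hj i hij'.le) (not_le.2 h2')
    | cast k => exact hτ ⟨i, j, k, hij', by simpa using hjk, by simpa using h1, h2'⟩

lemma nonLRMaxBound_appendValue {n : ℕ} (v : Fin (n + 1)) (τ : Equiv.Perm (Fin n))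
    (h : nonLRMaxBound τ ≤ v.val) :
    nonLRMaxBound (appendValue v τ) =
      if v = Fin.last n then nonLRMaxBound τ else v.val + 1 := by
  have key : ((nonLRMax τ).map Fin.castSuccEmb).sup
      (fun i => (appendValue v τ i).val + 1) = nonLRMaxBound τ := by
    rw [sup_map]
    refine sup_congr rfl fun i hi => ?_
    have := (nonLRMaxBound_le_iff τ _).1 h i (by simpa [nonLRMax] using hi)
    simp [val_succAbove_of_lt this]
  unfold nonLRMaxBound at key ⊢
  rw [nonLRMax_appendValue]
  split_ifs with hv
  · exact key
  · rw [sup_insert, key, appendValue_last]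
    exact sup_eq_left.2 (h.trans (Nat.le_succ _))

lemma invPerm_appendValue {n : ℕ} (v : Fin (n + 1)) (τ : Equiv.Perm (Fin n)) :
    invPerm (appendValue v τ) = invPerm τ + (n - v.val) := by
  have hcard : (univ.filter fun i : Fin n => v ≤ (τ i).castSucc).card = n - v.val := by
    rw [← card_map τ.toEmbedding]
    have : (univ.filter fun i : Fin n => v ≤ (τ i).castSucc).map τ.toEmbedding =
        univ.filter fun a : Fin n => ¬ a.val < v.val := by
      ext a
      simp only [mem_map_equiv, mem_filter, mem_univ, true_and, Equiv.apply_symm_apply, Fin.le_def,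
        Fin.val_castSucc, not_lt]
    rw [this, filter_not, card_sdiff_of_subset (filter_subset _ _)]
    simp [Fin.card_filter_val_lt, Nat.min_eq_right (Nat.lt_succ_iff.1 v.isLt)]
  have hsum : ∀ (m : ℕ) (σ : Equiv.Perm (Fin m)),
      invPerm σ = ∑ i, ∑ j, if i < j ∧ σ j < σ i then 1 else 0 := by
    intro m σ
    rw [invPerm, card_filter, Fintype.sum_prod_type]
  rw [hsum, hsum, ← hcard, card_filter, Fin.sum_univ_castSucc]
  simp only [Fin.sum_univ_castSucc, appendValue_castSucc, appendValue_last,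
    Fin.castSucc_lt_castSucc_iff, Fin.succAbove_lt_succAbove_iff, Fin.castSucc_lt_last, true_and,
    Fin.lt_succAbove_iff_le_castSucc, not_lt.2 (Fin.le_last _), false_and, if_false,
    sum_const_zero, add_zero, sum_add_distrib]

open scoped PowerSeries

/-- Signed enumeration of the 321-avoiding permutations by the number of positions which are not
left-right maxima, weighted by a function of the room left above the bound `nonLRMaxBound`. -/
noncomputable def signedSum (n : ℕ) (φ : ℕ → ℤ⟦X⟧) : ℤ⟦X⟧ :=
  ∑ σ ∈ Av n, (-1) ^ invPerm σ * PowerSeries.X ^ (nonLRMax σ).card * φ (n - nonLRMaxBound σ)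

lemma signedSum_sub (n : ℕ) (φ ψ : ℕ → ℤ⟦X⟧) :
    signedSum n φ - signedSum n ψ = signedSum n (fun h => φ h - ψ h) := by
  simp [signedSum, ← sum_sub_distrib, mul_sub]

lemma signedSum_add (n : ℕ) (φ ψ : ℕ → ℤ⟦X⟧) :
    signedSum n φ + signedSum n ψ = signedSum n (fun h => φ h + ψ h) := by
  simp [signedSum, ← sum_add_distrib, mul_add]

lemma mul_signedSum (n : ℕ) (c : ℤ⟦X⟧) (φ : ℕ → ℤ⟦X⟧) :
    c * signedSum n φ = signedSum n (fun h => c * φ h) := by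
  simp only [signedSum, mul_sum]
  exact sum_congr rfl fun _ _ => by ring

lemma signedSum_succ (n : ℕ) (φ : ℕ → ℤ⟦X⟧) :
    signedSum (n + 1) φ = signedSum n fun h =>
      φ (h + 1) + PowerSeries.X * ∑ j ∈ Icc 1 h, (-1) ^ j * φ j := by
  have hbij := (Fintype.sum_bijective _ (appendValue_bijective n)
    (fun p => if Avoids321 (appendValue p.2 p.1) then
      (-1 : ℤ⟦X⟧) ^ invPerm (appendValue p.2 p.1) *
        PowerSeries.X ^ (nonLRMax (appendValue p.2 p.1)).card *
          φ (n + 1 - nonLRMaxBound (appendValue p.2 p.1)) else 0)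
    (fun σ => if Avoids321 σ then
      (-1 : ℤ⟦X⟧) ^ invPerm σ * PowerSeries.X ^ (nonLRMax σ).card *
        φ (n + 1 - nonLRMaxBound σ) else 0) fun _ => rfl).symm
  simp only [signedSum, Av, sum_filter]
  rw [hbij, Fintype.sum_prod_type]
  refine sum_congr rfl fun τ _ => ?_
  by_cases hτ : Avoids321 τ
  swap
  · simp [avoids321_appendValue, hτ]
  have hb := nonLRMaxBound_le τ
  rw [if_pos hτ, Fin.sum_univ_castSucc]
  have hlast : Avoids321 (appendValue (Fin.last n) τ) :=
    (avoids321_appendValue _ _).2 ⟨hτ, by simpa using hb⟩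
  rw [if_pos hlast, invPerm_appendValue, card_nonLRMax_appendValue,
    nonLRMaxBound_appendValue _ _ (by simpa using hb), if_pos rfl, if_pos rfl, mul_add, add_comm]
  congr 1
  · rw [Nat.sub_add_comm hb]
    simp
  · have hterm : ∀ v : Fin n, (if Avoids321 (appendValue v.castSucc τ) then
        (-1 : ℤ⟦X⟧) ^ invPerm (appendValue v.castSucc τ) *
          PowerSeries.X ^ (nonLRMax (appendValue v.castSucc τ)).card *
            φ (n + 1 - nonLRMaxBound (appendValue v.castSucc τ)) else 0) =
        (fun a : ℕ => if nonLRMaxBound τ ≤ a then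
          (-1 : ℤ⟦X⟧) ^ invPerm τ * PowerSeries.X ^ (nonLRMax τ).card *
            (PowerSeries.X * ((-1) ^ (n - a) * φ (n - a))) else 0) v.val := by
      intro v
      simp only [avoids321_appendValue, hτ, true_and, Fin.val_castSucc]
      split_ifs with h
      · rw [invPerm_appendValue, card_nonLRMax_appendValue,
          nonLRMaxBound_appendValue _ _ (by simpa using h),
          if_neg (Fin.castSucc_ne_last v), if_neg (Fin.castSucc_ne_last v), Fin.val_castSucc,
          Nat.add_sub_add_right]
        ring
      · rfl
    rw [sum_congr rfl fun v _ => hterm v, Fin.sum_univ_eq_sum_range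
      (fun a : ℕ => if nonLRMaxBound τ ≤ a then
          (-1 : ℤ⟦X⟧) ^ invPerm τ * PowerSeries.X ^ (nonLRMax τ).card *
            (PowerSeries.X * ((-1) ^ (n - a) * φ (n - a))) else 0) n,
      ← sum_filter, mul_sum, mul_sum]
    refine sum_nbij' (fun a => n - a) (fun j => n - j) ?_ ?_ ?_ ?_ ?_
    · intro a; simp only [mem_filter, mem_range, mem_Icc]; omega
    · intro a; simp only [mem_filter, mem_range, mem_Icc]; omega
    · intro a; simp only [mem_filter, mem_range]; omega
    · intro a; simp only [mem_Icc]; omega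
    · intro a _; rfl

/-- The part of the signed enumeration where the room above `nonLRMaxBound` is at least `h`. -/
noncomputable def signedTail (n h : ℕ) : ℤ⟦X⟧ := signedSum n fun a => if h ≤ a then 1 else 0

lemma signedTail_of_lt {n h : ℕ} (hn : n < h) : signedTail n h = 0 :=
  sum_eq_zero fun σ _ => by
    have : ¬ h ≤ n - nonLRMaxBound σ := by omega
    simp [this]

lemma signedTail_zero_zero : signedTail 0 0 = 1 := by
  have h : Av 0 = {1} := by decide
  simp [signedTail, signedSum, h, invPerm, nonLRMax]

lemma signedTail_succ_zero (n : ℕ) : signedTail (n + 1) 0 = signedTail (n + 1) 1 := by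
  simp only [signedTail, signedSum_succ]
  congr 1
  ext1 a
  congr 2
  · simp
  · exact sum_congr rfl fun j hj => by simp [(mem_Icc.1 hj).1]

lemma signedTail_succ_sub (n h : ℕ) :
    signedTail (n + 1) (h + 1) - signedTail (n + 1) (h + 2) =
      signedTail n h - signedTail n (h + 1) +
        (-1) ^ (h + 1) * PowerSeries.X * signedTail n (h + 1) := by
  simp only [signedTail]
  rw [signedSum_sub, signedSum_succ, mul_signedSum, signedSum_sub, signedSum_add]
  congr 1
  ext1 a
  have hind : ∀ j : ℕ, ((if h + 1 ≤ j then 1 else 0) - if h + 2 ≤ j then 1 else 0 : ℤ⟦X⟧) =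
      if j = h + 1 then 1 else 0 := by
    intro j
    split_ifs <;> first | omega | simp
  simp only [hind, mul_ite, mul_one, mul_zero, sum_ite_eq', mem_Icc]
  congr 1
  · split_ifs <;> first | omega | simp
  · split_ifs <;> first | omega | ring

lemma eq_of_sub_succ_eq {a b : ℕ → ℤ⟦X⟧} (N : ℕ) (hN : ∀ h, N ≤ h → a h = b h)
    (hd : ∀ h, a h - a (h + 1) = b h - b (h + 1)) (h : ℕ) : a h = b h := by
  by_cases hh : N ≤ h
  · exact hN h hh
  · have ih := eq_of_sub_succ_eq N hN hd (h + 1)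
    linear_combination hd h + ih
termination_by N - h

/-- The closed form of `signedTail` in odd size `2 * m + 1`, at `2 * i` and `2 * i + 1`. -/
noncomputable def oddTail (m i : ℕ) : ℤ⟦X⟧ :=
  if i ≤ m then
    PowerSeries.mk fun d => (-1) ^ d * ((m - i).choose ((d + 1) / 2) : ℤ) * (m.choose (d / 2) : ℤ)
  else 0

lemma coeff_oddTail_add (i e d : ℕ) : PowerSeries.coeff d (oddTail (i + e) i) =
    (-1) ^ d * (e.choose ((d + 1) / 2) : ℤ) * ((i + e).choose (d / 2) : ℤ) := by
  simp [oddTail]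

lemma oddTail_of_lt {m i : ℕ} (h : m < i) : oddTail m i = 0 := by
  simp [oddTail, not_le.2 h]

lemma oddTail_self (m : ℕ) : oddTail m m = 1 := by
  ext d
  have h := coeff_oddTail_add m 0 d
  rw [add_zero] at h
  rw [h, PowerSeries.coeff_one]
  rcases d with _ | d
  · simp
  · have : (d + 1 + 1) / 2 = d / 2 + 1 := by omega
    simp [this]

lemma oddTail_succ_zero_sub (m : ℕ) : oddTail (m + 1) 0 - oddTail (m + 1) 1 =
    (PowerSeries.X ^ 2 - PowerSeries.X) * oddTail m 0 := by
  ext d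
  have h0 := fun d => coeff_oddTail_add 0 m d
  have h1 := fun d => coeff_oddTail_add 0 (m + 1) d
  have h2 := fun d => coeff_oddTail_add 1 m d
  simp only [zero_add] at h0 h1
  rw [add_comm 1 m] at h2
  rw [sub_mul, pow_two, mul_assoc, map_sub, map_sub, h1, h2]
  rcases d with _ | _ | d
  · simp
  · simp [h0]
  · obtain ⟨p, rfl | rfl⟩ := Nat.even_or_odd' d
    · have e1 : (2 * p + 1 + 1) / 2 = p + 1 := by omega
      have e2 : (2 * p + 1 + 1 + 1) / 2 = p + 1 := by omega
      have e3 : (2 * p + 1) / 2 = p := by omega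
      have e4 : 2 * p / 2 = p := by omega
      simp only [PowerSeries.coeff_succ_X_mul, h0, e1, e2, e3, e4, Nat.choose_succ_succ, pow_succ,
        pow_mul]
      push_cast
      ring
    · have e1 : (2 * p + 1 + 1 + 1) / 2 = p + 1 := by omega
      have e2 : (2 * p + 1 + 1 + 1 + 1) / 2 = p + 2 := by omega
      have e3 : (2 * p + 1 + 1) / 2 = p + 1 := by omega
      have e4 : (2 * p + 1) / 2 = p := by omega
      simp only [PowerSeries.coeff_succ_X_mul, h0, e1, e2, e3, e4, Nat.choose_succ_succ, pow_succ,
        pow_mul]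
      push_cast
      ring

lemma oddTail_succ_succ_sub (m i : ℕ) : oddTail (m + 1) (i + 1) - oddTail (m + 1) (i + 2) =
    oddTail m i - (1 - PowerSeries.X ^ 2) * oddTail m (i + 1) := by
  rcases lt_trichotomy m i with h | rfl | h
  · simp [oddTail_of_lt, h, h.trans (Nat.lt_succ_self _), (Nat.succ_lt_succ h).trans]
  · simp [oddTail_of_lt, oddTail_self]
  obtain ⟨e, rfl⟩ := Nat.exists_eq_add_of_lt h
  ext d
  have h0 := fun d => coeff_oddTail_add i (e + 1) d
  have h1 := fun d => coeff_oddTail_add (i + 1) e d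
  have h2 := fun d => coeff_oddTail_add (i + 1) (e + 1) d
  have h3 := fun d => coeff_oddTail_add (i + 2) e d
  rw [show i + 1 + e = i + e + 1 by ring] at h1
  rw [show i + 1 + (e + 1) = i + e + 1 + 1 by ring] at h2
  rw [show i + 2 + e = i + e + 1 + 1 by ring] at h3
  rw [← add_assoc] at h0
  rw [sub_mul, one_mul, pow_two, mul_assoc, map_sub, map_sub, map_sub, h0, h1, h2, h3]
  rcases d with _ | _ | d
  · simp
  · simp
  · obtain ⟨p, rfl | rfl⟩ := Nat.even_or_odd' d
    · have e1 : (2 * p + 1 + 1) / 2 = p + 1 := by omega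
      have e2 : (2 * p + 1 + 1 + 1) / 2 = p + 1 := by omega
      have e3 : (2 * p + 1) / 2 = p := by omega
      have e4 : 2 * p / 2 = p := by omega
      simp only [PowerSeries.coeff_succ_X_mul, h1, e1, e2, e3, e4, Nat.choose_succ_succ, pow_succ,
        pow_mul]
      push_cast
      ring
    · have e1 : (2 * p + 1 + 1 + 1) / 2 = p + 1 := by omega
      have e2 : (2 * p + 1 + 1 + 1 + 1) / 2 = p + 2 := by omega
      have e3 : (2 * p + 1 + 1) / 2 = p + 1 := by omega
      have e4 : (2 * p + 1) / 2 = p := by omega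
      simp only [PowerSeries.coeff_succ_X_mul, h1, e1, e2, e3, e4, Nat.choose_succ_succ, pow_succ,
        pow_mul]
      push_cast
      ring

lemma signedTail_even (m : ℕ) (hodd : ∀ h, signedTail (2 * m + 1) h = oddTail m (h / 2)) (h : ℕ) :
    signedTail (2 * m + 2) (h + 1) =
      (if Even h then 1 - PowerSeries.X else 1) * oddTail m (h / 2) := by
  refine eq_of_sub_succ_eq (a := fun h => signedTail (2 * m + 2) (h + 1))
    (b := fun h => (if Even h then 1 - PowerSeries.X else 1) * oddTail m (h / 2)) (2 * m + 2)
    (fun h hh => ?_) (fun h => ?_) h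
  · rw [signedTail_of_lt (by omega), oddTail_of_lt (by omega), mul_zero]
  · rw [signedTail_succ_sub, hodd, hodd]
    obtain ⟨p, rfl | rfl⟩ := Nat.even_or_odd' h
    · have e1 : (2 * p + 1) / 2 = p := by omega
      have e2 : 2 * p / 2 = p := by omega
      simp only [e1, e2, even_two_mul, Nat.not_even_bit1, if_true, if_false, pow_succ, pow_mul]
      ring
    · have e1 : (2 * p + 1 + 1) / 2 = p + 1 := by omega
      have e2 : (2 * p + 1) / 2 = p := by omega
      have e3 : Even (2 * p + 1 + 1) := ⟨p + 1, by ring⟩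
      simp only [e1, e2, e3, Nat.not_even_bit1, if_true, if_false, pow_succ, pow_mul]
      ring

lemma signedTail_odd (m h : ℕ) : signedTail (2 * m + 1) h = oddTail m (h / 2) := by
  induction m generalizing h with
  | zero =>
    have h1 : signedTail 1 1 = 1 := by
      have := signedTail_succ_sub 0 0
      rw [signedTail_zero_zero, signedTail_of_lt (n := 0) (h := 0 + 1) (by omega),
        signedTail_of_lt (n := 0 + 1) (h := 0 + 2) (by omega)] at this
      simpa using this
    rcases h with _ | _ | h
    · simpa [oddTail_self] using (signedTail_succ_zero 0).trans h1
    · simpa [oddTail_self] using h1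
    · rw [signedTail_of_lt (by omega), oddTail_of_lt (by omega)]
  | succ m ih =>
    have hev := signedTail_even m ih
    have hpos : ∀ h, signedTail (2 * m + 2 + 1) (h + 1) = oddTail (m + 1) ((h + 1) / 2) := by
      refine eq_of_sub_succ_eq (a := fun h => signedTail (2 * m + 2 + 1) (h + 1))
        (b := fun h => oddTail (m + 1) ((h + 1) / 2)) (2 * m + 3) (fun h hh => ?_) (fun h => ?_)
      · rw [signedTail_of_lt (by omega), oddTail_of_lt (by omega)]
      · rw [signedTail_succ_sub]
        rcases h with _ | h
        · rw [signedTail_succ_zero, hev]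
          have := oddTail_succ_zero_sub m
          simp only [zero_add, Nat.reduceDiv, Nat.reduceAdd, Even.zero, if_true]
          linear_combination -this
        · rw [hev, hev]
          obtain ⟨p, rfl | rfl⟩ := Nat.even_or_odd' h
          · have e1 : (2 * p + 1 + 1) / 2 = p + 1 := by omega
            have e2 : (2 * p + 1 + 1 + 1) / 2 = p + 1 := by omega
            have e3 : (2 * p + 1) / 2 = p := by omega
            have e4 : 2 * p / 2 = p := by omega
            simp only [e1, e2, e3, e4, even_two_mul, Nat.not_even_bit1, if_true, if_false, pow_succ,
              pow_mul]
            ring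
          · have e1 : (2 * p + 1 + 1 + 1) / 2 = p + 1 := by omega
            have e2 : (2 * p + 1 + 1 + 1 + 1) / 2 = p + 2 := by omega
            have e3 : (2 * p + 1 + 1) / 2 = p + 1 := by omega
            have e4 : (2 * p + 1) / 2 = p := by omega
            have e5 : Even (2 * p + 1 + 1) := ⟨p + 1, by ring⟩
            have := oddTail_succ_succ_sub m p
            simp only [e1, e2, e3, e4, e5, Nat.not_even_bit1, if_true, if_false, pow_succ, pow_mul]
            linear_combination -this
    rcases h with _ | h
    · exact (signedTail_succ_zero (2 * m + 2)).trans (hpos 0)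
    · exact hpos h

lemma coeff_signedTail_succ_zero (n d : ℕ) :
    PowerSeries.coeff d (signedTail (n + 1) 0) =
      (-1 : ℤ) ^ d * (((n + 1) / 2).choose ((d + 1) / 2) : ℤ) * ((n / 2).choose (d / 2) : ℤ) := by
  have hcoeff := fun m d => coeff_oddTail_add 0 m d
  simp only [zero_add] at hcoeff
  obtain ⟨m, rfl | rfl⟩ := Nat.even_or_odd' n
  · have e1 : (2 * m + 1) / 2 = m := by omega
    have e2 : 2 * m / 2 = m := by omega
    rw [signedTail_odd, Nat.zero_div, hcoeff, e1, e2]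
  · have e1 : (2 * m + 1 + 1) / 2 = m + 1 := by omega
    have e2 : (2 * m + 1) / 2 = m := by omega
    have h0 := signedTail_even m (signedTail_odd m) 0
    rw [zero_add] at h0
    rw [signedTail_succ_zero, h0, if_pos Even.zero, Nat.zero_div, sub_mul, one_mul, map_sub, e1, e2, hcoeff]
    rcases d with _ | d
    · simp
    · rw [PowerSeries.coeff_succ_X_mul, hcoeff]
      obtain ⟨p, rfl | rfl⟩ := Nat.even_or_odd' d
      · have e3 : (2 * p + 1 + 1) / 2 = p + 1 := by omega
        have e4 : (2 * p + 1) / 2 = p := by omega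
        have e5 : 2 * p / 2 = p := by omega
        simp only [e3, e4, e5, Nat.choose_succ_succ, pow_succ]
        push_cast
        ring
      · have e3 : (2 * p + 1 + 1 + 1) / 2 = p + 1 := by omega
        have e4 : (2 * p + 1 + 1) / 2 = p + 1 := by omega
        have e5 : (2 * p + 1) / 2 = p := by omega
        simp only [e3, e4, e5, Nat.choose_succ_succ, pow_succ]
        push_cast
        ring

lemma coeff_signedTail_sub {n k : ℕ} (hk : 1 ≤ k) (hkn : k ≤ n) :
    PowerSeries.coeff (n - k) (signedTail n 0) =
      (-1 : ℤ) ^ (n - k) * (Nat.choose ((n - 1) / 2) ((k - 1) / 2) : ℤ) *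
        (Nat.choose (n / 2) (k / 2) : ℤ) := by
  obtain ⟨n, rfl⟩ := Nat.exists_eq_add_of_le' (hk.trans hkn)
  rw [coeff_signedTail_succ_zero, Nat.add_sub_cancel]
  obtain ⟨m, rfl | rfl⟩ := Nat.even_or_odd' n
  · have e1 : (2 * m + 1) / 2 = m := by omega
    have e2 : 2 * m / 2 = m := by omega
    have e3 : (2 * m + 1 - k + 1) / 2 = m - (k - 1) / 2 := by omega
    have e4 : (2 * m + 1 - k) / 2 = m - k / 2 := by omega
    rw [e1, e2, e3, e4, Nat.choose_symm (by omega), Nat.choose_symm (by omega)]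
  · have e1 : (2 * m + 1 + 1) / 2 = m + 1 := by omega
    have e2 : (2 * m + 1) / 2 = m := by omega
    have e3 : (2 * m + 1 + 1 - k + 1) / 2 = m + 1 - k / 2 := by omega
    have e4 : (2 * m + 1 + 1 - k) / 2 = m - (k - 1) / 2 := by omega
    rw [e1, e2, e3, e4, Nat.choose_symm (by omega), Nat.choose_symm (by omega)]
    ring

lemma coeff_signedTail_self {n : ℕ} (hn : 1 ≤ n) :
    PowerSeries.coeff n (signedTail n 0) = 0 := by
  obtain ⟨n, rfl⟩ := Nat.exists_eq_add_of_le' hn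
  rw [coeff_signedTail_succ_zero]
  obtain ⟨m, rfl | rfl⟩ := Nat.even_or_odd' n
  · rw [Nat.choose_eq_zero_of_lt (show (2 * m + 1) / 2 < (2 * m + 1 + 1) / 2 by omega)]
    simp
  · rw [Nat.choose_eq_zero_of_lt (show (2 * m + 1) / 2 < (2 * m + 1 + 1) / 2 by omega)]
    simp

lemma coeff_sum_lrm {n k : ℕ} (hk : k ≤ n) :
    (∑ σ ∈ Av n, Polynomial.C ((-1 : ℤ) ^ invPerm σ) * Polynomial.X ^ lrm σ).coeff k =
      PowerSeries.coeff (n - k) (signedTail n 0) := by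
  rw [Polynomial.finsetSum_coeff, signedTail, signedSum, map_sum]
  refine sum_congr rfl fun σ _ => ?_
  have hσ := lrm_add_card_nonLRMax σ
  have hC : (-1 : ℤ⟦X⟧) ^ invPerm σ = PowerSeries.C ((-1 : ℤ) ^ invPerm σ) := by simp
  have hiff : k = lrm σ ↔ n - k = (nonLRMax σ).card := by omega
  rw [if_pos (Nat.zero_le _), mul_one, hC, PowerSeries.coeff_C_mul, Polynomial.coeff_C_mul,
    Polynomial.coeff_X_pow, PowerSeries.coeff_X_pow]
  simp only [hiff]

/-- refined signed enumeration: for n ≥ 1, in ℤ[t],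
`Σ_{σ∈Av_n(321)} (-1)^{inv σ} t^{lrm σ}
  = Σ_{k=1}^{n} (-1)^{n-k} binom(⌊(n-1)/2⌋,⌊(k-1)/2⌋) binom(⌈(n-1)/2⌉,⌈(k-1)/2⌉) t^k`
(note `⌈(n-1)/2⌉ = n/2` and `⌈(k-1)/2⌉ = k/2`, rounding down, for `n, k ≥ 1`). -/
theorem stmt18 (n : ℕ) (hn : 1 ≤ n) :
    (∑ σ ∈ Av n, Polynomial.C ((-1 : ℤ) ^ invPerm σ) * Polynomial.X ^ lrm σ) =
      ∑ k ∈ Finset.Icc 1 n,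
        Polynomial.C ((-1 : ℤ) ^ (n - k) * (Nat.choose ((n - 1) / 2) ((k - 1) / 2) : ℤ) *
          (Nat.choose (n / 2) (k / 2) : ℤ)) * Polynomial.X ^ k := by
  ext k
  have hrhs : (∑ j ∈ Finset.Icc 1 n,
        Polynomial.C ((-1 : ℤ) ^ (n - j) * (Nat.choose ((n - 1) / 2) ((j - 1) / 2) : ℤ) *
          (Nat.choose (n / 2) (j / 2) : ℤ)) * Polynomial.X ^ j).coeff k =
      if k ∈ Finset.Icc 1 n then
        (-1 : ℤ) ^ (n - k) * (Nat.choose ((n - 1) / 2) ((k - 1) / 2) : ℤ) *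
          (Nat.choose (n / 2) (k / 2) : ℤ) else 0 := by
    simp only [Polynomial.finsetSum_coeff, Polynomial.coeff_C_mul, Polynomial.coeff_X_pow,
      mul_ite, mul_one, mul_zero, Finset.sum_ite_eq]
  rw [hrhs]
  rcases le_or_gt k n with hkn | hkn
  · rw [coeff_sum_lrm hkn]
    rcases Nat.eq_zero_or_pos k with rfl | hk
    · simpa using coeff_signedTail_self hn
    · rw [if_pos (Finset.mem_Icc.2 ⟨hk, hkn⟩), coeff_signedTail_sub hk hkn]
  · rw [if_neg (by simp [hkn]), Polynomial.finsetSum_coeff]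
    refine Finset.sum_eq_zero fun σ _ => ?_
    have hσ := lrm_add_card_nonLRMax σ
    rw [Polynomial.coeff_C_mul, Polynomial.coeff_X_pow, if_neg (by omega), mul_zero]
end

section
/- Let I_m(−1,t) ∈ ℤ[t] denote Σ_{σ∈Av_m(321)} (−1)^{inv σ} t^{lrm σ}. Then for every integer n ≥ 1, I_{2n}(−1,t) = (t−1)·I_{2n−1}(−1,t), and for every integer n ≥ 2, (n+1)·I_{2n+1}(−1,t) = 2((1+t²)n − t)·I_{2n−1}(−1,t) − (1−t²)²(n−1)·I_{2n−3}(−1,t), as identities in ℤ[t]. -/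
open Finset MvPolynomial

/-- The permutation of `Fin (n + 1)` whose last value is `v` and whose other values are
order-isomorphic to `τ`. -/
def appendLast {n : ℕ} (v : Fin (n + 1)) (τ : Equiv.Perm (Fin n)) : Equiv.Perm (Fin (n + 1)) :=
  (finSuccEquiv' (Fin.last n)).trans ((Equiv.optionCongr τ).trans (finSuccEquiv' v).symm)

@[simp]
lemma appendLast_last {n : ℕ} (v : Fin (n + 1)) (τ : Equiv.Perm (Fin n)) :
    appendLast v τ (Fin.last n) = v := by
  simp [appendLast]

@[simp]
lemma appendLast_castSucc {n : ℕ} (v : Fin (n + 1)) (τ : Equiv.Perm (Fin n)) (i : Fin n) :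
    appendLast v τ i.castSucc = v.succAbove (τ i) := by
  simp [appendLast, finSuccEquiv'_last_apply_castSucc]

lemma appendLast_bijective (n : ℕ) :
    Function.Bijective
      (fun p : Fin (n + 1) × Equiv.Perm (Fin n) => appendLast p.1 p.2) := by
  rw [Fintype.bijective_iff_injective_and_card]
  refine ⟨?_, by simp [Fintype.card_perm, Nat.factorial_succ]⟩
  rintro ⟨v, τ⟩ ⟨w, ρ⟩ h
  have hvw : v = w := by simpa using DFunLike.congr_fun h (Fin.last n)
  subst hvw
  refine Prod.ext rfl (Equiv.ext fun i => ?_)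
  simpa using DFunLike.congr_fun h i.castSucc

/-- One more than the largest value at the bottom of an inversion of `σ`; it is `0` if `σ` is the
identity. A value can be appended to a 321-avoiding `σ` iff it is at least `bottomBound σ`. -/
def bottomBound {n : ℕ} (σ : Equiv.Perm (Fin n)) : ℕ :=
  (univ.filter (fun p : Fin n × Fin n => p.1 < p.2 ∧ σ p.2 < σ p.1)).sup
    fun p => (σ p.2).val + 1

lemma bottomBound_le_iff {n : ℕ} (σ : Equiv.Perm (Fin n)) (b : ℕ) :
    bottomBound σ ≤ b ↔ ∀ i j, i < j → σ j < σ i → (σ j).val < b := by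
  simp [bottomBound, Finset.sup_le_iff]

lemma bottomBound_le {n : ℕ} (σ : Equiv.Perm (Fin n)) : bottomBound σ ≤ n :=
  (bottomBound_le_iff σ n).2 fun _ j _ _ => (σ j).isLt

lemma lt_succAbove_iff_val_le {n : ℕ} (v : Fin (n + 1)) (a : Fin n) :
    v < v.succAbove a ↔ v.val ≤ a.val := by
  rw [Fin.lt_succAbove_iff_le_castSucc, Fin.le_def, Fin.val_castSucc]

lemma avoids321_appendLast_iff {n : ℕ} (v : Fin (n + 1)) (τ : Equiv.Perm (Fin n)) :
    Avoids321 (appendLast v τ) ↔ Avoids321 τ ∧ bottomBound τ ≤ v.val := by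
  rw [bottomBound_le_iff]
  constructor
  · refine fun h => ⟨?_, fun i j hij hτ => ?_⟩
    · rintro ⟨i, j, k, hij, hjk, h1, h2⟩
      exact h ⟨i.castSucc, j.castSucc, k.castSucc, by simpa, by simpa, by simpa, by simpa⟩
    · by_contra! hv
      exact h ⟨i.castSucc, j.castSucc, Fin.last n, by simpa, Fin.castSucc_lt_last j,
        by simpa [lt_succAbove_iff_val_le] using hv, by simpa⟩
  · rintro ⟨h, hb⟩ ⟨i, j, k, hij, hjk, h1, h2⟩
    induction i using Fin.lastCases with
    | last => exact absurd hij (not_lt.2 (Fin.le_last j))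
    | cast i =>
    induction j using Fin.lastCases with
    | last => exact absurd hjk (not_lt.2 (Fin.le_last k))
    | cast j =>
    simp only [Fin.castSucc_lt_castSucc_iff] at hij
    simp only [appendLast_castSucc, Fin.succAbove_lt_succAbove_iff] at h2
    induction k using Fin.lastCases with
    | last =>
      simp only [appendLast_last, appendLast_castSucc, lt_succAbove_iff_val_le] at h1
      exact absurd (hb i j hij h2) (not_lt.2 h1)
    | cast k =>
      simp only [Fin.castSucc_lt_castSucc_iff] at hjk
      simp only [appendLast_castSucc, Fin.succAbove_lt_succAbove_iff] at h1
      exact h ⟨i, j, k, hij, hjk, h1, h2⟩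

lemma invPerm_eq_sum {n : ℕ} (σ : Equiv.Perm (Fin n)) :
    invPerm σ = ∑ i, ∑ j, if i < j ∧ σ j < σ i then 1 else 0 := by
  rw [invPerm, Finset.card_filter, Fintype.sum_prod_type]

lemma card_filter_val_le {n : ℕ} (v : Fin (n + 1)) :
    #{i : Fin n | v.val ≤ i.val} = n - v.val := by
  have h := Fin.card_filter_val_lt (n := n) (m := v.val)
  have h' := Finset.card_filter_add_card_filter_not (s := (univ : Finset (Fin n)))
    (p := fun i => i.val < v.val)
  simp only [not_lt, card_univ, Fintype.card_fin] at h'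
  have := v.isLt
  omega

lemma invPerm_appendLast {n : ℕ} (v : Fin (n + 1)) (τ : Equiv.Perm (Fin n)) :
    invPerm (appendLast v τ) = invPerm τ + (n - v.val) := by
  have hlast : ∀ i : Fin n, ¬ Fin.last n < i.castSucc := fun i => not_lt.2 (Fin.le_last _)
  have hcount : ∑ i, (if v.val ≤ (τ i).val then 1 else 0) = n - v.val := by
    rw [Equiv.sum_comp τ fun i => if v.val ≤ i.val then 1 else 0, ← Finset.card_filter,
      card_filter_val_le]
  rw [invPerm_eq_sum, invPerm_eq_sum, Fin.sum_univ_castSucc]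
  simp [Fin.sum_univ_castSucc, hlast, Fin.castSucc_lt_last, lt_succAbove_iff_val_le,
    Finset.sum_add_distrib, - Finset.sum_boole, hcount]

lemma lrm_appendLast {n : ℕ} (v : Fin (n + 1)) (τ : Equiv.Perm (Fin n)) :
    lrm (appendLast v τ) = lrm τ + if v = Fin.last n then 1 else 0 := by
  have hcast : ∀ i : Fin n, IsLRMax (appendLast v τ) i.castSucc ↔ IsLRMax τ i := by
    intro i
    refine ⟨fun h j hj => by simpa using h j.castSucc (by simpa), fun h j hj => ?_⟩
    induction j using Fin.lastCases with
    | last => exact absurd (Fin.castSucc_lt_last i) (not_lt.2 hj)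
    | cast j => simpa using h j (by simpa using hj)
  have hlast : IsLRMax (appendLast v τ) (Fin.last n) ↔ v = Fin.last n := by
    constructor
    · intro h
      obtain ⟨j, hj⟩ := (appendLast v τ).surjective (Fin.last n)
      have := h j (Fin.le_last j)
      rw [hj, appendLast_last] at this
      exact Fin.last_le_iff.1 this
    · rintro rfl j -
      simpa using Fin.le_last _
  rw [lrm, lrm, Finset.card_filter, Finset.card_filter, Fin.sum_univ_castSucc]
  simp only [hcast, hlast]

lemma bottomBound_appendLast_last {n : ℕ} (τ : Equiv.Perm (Fin n)) :
    bottomBound (appendLast (Fin.last n) τ) = bottomBound τ := by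
  refine eq_of_forall_ge_iff fun b => ?_
  rw [bottomBound_le_iff, bottomBound_le_iff]
  refine ⟨fun h i j hij hτ => by simpa using h i.castSucc j.castSucc (by simpa) (by simpa),
    fun h i j hij hσ => ?_⟩
  induction j using Fin.lastCases with
  | last => exact absurd hσ (not_lt.2 (by simpa using Fin.le_last _))
  | cast j =>
  induction i using Fin.lastCases with
  | last => exact absurd hij (not_lt.2 (Fin.le_last _))
  | cast i => simpa using h i j (by simpa using hij) (by simpa using hσ)

lemma bottomBound_appendLast_castSucc {n : ℕ} (w : Fin n) (τ : Equiv.Perm (Fin n))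
    (hw : bottomBound τ ≤ w.val) :
    bottomBound (appendLast w.castSucc τ) = w.val + 1 := by
  apply le_antisymm
  · rw [bottomBound_le_iff] at hw ⊢
    intro i j hij hσ
    induction i using Fin.lastCases with
    | last => exact absurd hij (not_lt.2 (Fin.le_last j))
    | cast i =>
    induction j using Fin.lastCases with
    | last => simp
    | cast j =>
      simp only [Fin.castSucc_lt_castSucc_iff] at hij
      simp only [appendLast_castSucc, Fin.succAbove_lt_succAbove_iff] at hσ
      have := hw i j hij hσ
      rw [appendLast_castSucc, Fin.succAbove_of_castSucc_lt _ _ (by simpa using this)]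
      simp; omega
  · have h := (bottomBound_le_iff (appendLast w.castSucc τ) _).1 le_rfl
      (τ.symm w).castSucc (Fin.last n) (Fin.castSucc_lt_last _)
      (by simp)
    simpa using h

/-- The transfer operator describing how the weight `q ^ inv σ * t ^ lrm σ * f (n - bottomBound σ)`
of a 321-avoiding `σ` is distributed when a last value is appended to `σ`. -/
def transfer {R : Type*} [CommRing R] (q t : R) (f : ℕ → R) (g : ℕ) : R :=
  t * f (g + 1) + ∑ i ∈ Icc 1 g, q ^ i * f i

lemma sum_fin_reflect {M : Type*} [AddCommMonoid M] {n b : ℕ} (hb : b ≤ n) (f : ℕ → M) :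
    ∑ w : Fin n, (if b ≤ w.val then f (n - w.val) else 0) = ∑ i ∈ Icc 1 (n - b), f i := by
  rw [Fin.sum_univ_eq_sum_range (fun w => if b ≤ w then f (n - w) else 0) n,
    ← Finset.sum_filter]
  refine Finset.sum_bij' (fun w _ => n - w) (fun i _ => n - i) ?_ ?_ ?_ ?_ ?_
  all_goals
    intro w hw
    simp only [Finset.mem_filter, Finset.mem_range, Finset.mem_Icc] at hw ⊢
    try omega

lemma sum_Av_succ_s19 {R : Type*} [CommRing R] (q t : R) (f : ℕ → R) (n : ℕ) :
    ∑ σ ∈ Av (n + 1), q ^ invPerm σ * t ^ lrm σ * f (n + 1 - bottomBound σ) =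
      ∑ τ ∈ Av n, q ^ invPerm τ * t ^ lrm τ * transfer q t f (n - bottomBound τ) := by
  rw [Av, Av, Finset.sum_filter, Finset.sum_filter,
    ← (appendLast_bijective n).sum_comp, Fintype.sum_prod_type_right]
  refine Finset.sum_congr rfl fun τ _ => ?_
  have hb := bottomBound_le τ
  by_cases hτ : Avoids321 τ
  swap
  · simp [avoids321_appendLast_iff, hτ]
  simp only [avoids321_appendLast_iff, hτ, true_and, if_true]
  rw [Fin.sum_univ_castSucc, add_comm, transfer, mul_add, ← sum_fin_reflect hb fun i => q ^ i * f i,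
    Finset.mul_sum]
  congr 1
  · rw [Fin.val_last, if_pos hb, invPerm_appendLast, lrm_appendLast, bottomBound_appendLast_last,
      Nat.sub_add_comm hb]
    simp [pow_succ, mul_assoc]
  · refine Finset.sum_congr rfl fun w _ => ?_
    rw [Fin.val_castSucc]
    split_ifs with h
    · rw [invPerm_appendLast, lrm_appendLast, bottomBound_appendLast_castSucc w τ h,
        if_neg (Fin.castSucc_lt_last w).ne, Fin.val_castSucc, Nat.add_sub_add_right, pow_add]
      ring
    · simp

lemma sum_Av_eq_iterate_transfer {R : Type*} [CommRing R] (q t : R) (f : ℕ → R) (n : ℕ) :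
    ∑ σ ∈ Av n, q ^ invPerm σ * t ^ lrm σ * f (n - bottomBound σ) =
      (transfer q t)^[n] f 0 := by
  induction n generalizing f with
  | zero =>
    have h : Av 0 = univ := Finset.filter_true_of_mem fun σ _ ⟨i, _⟩ => i.elim0
    simp [h, invPerm, lrm]
  | succ n ih => rw [sum_Av_succ_s19, ih, Function.iterate_succ_apply]

lemma ISign_eq_iterate_transfer (n : ℕ) :
    ISign n = (transfer (-1) (Polynomial.X : Polynomial ℤ))^[n] (fun _ => 1) 0 := by
  rw [← sum_Av_eq_iterate_transfer, ISign]
  simp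

/-- The generating series, by number of appended values, of the iterates of `transfer` started at
the constant function `1`. -/
noncomputable def transferSeries {R : Type*} [CommRing R] (q t : R) (g : ℕ) : PowerSeries R :=
  PowerSeries.mk fun n => (transfer q t)^[n] (fun _ => 1) g

section
variable {R : Type*} [CommRing R] (q t : R)

lemma transferSeries_eq (g : ℕ) :
    transferSeries q t g = 1 + PowerSeries.X * (PowerSeries.C t * transferSeries q t (g + 1) +
      ∑ i ∈ Icc 1 g, PowerSeries.C (q ^ i) * transferSeries q t i) := by
  ext n
  cases n with
  | zero => simp [transferSeries]
  | succ n =>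
    rw [transferSeries, PowerSeries.coeff_mk, Function.iterate_succ_apply', map_add,
      PowerSeries.coeff_succ_X_mul]
    simp [transfer, transferSeries, PowerSeries.coeff_one, -map_pow]

lemma transferSeries_zero :
    transferSeries q t 0 = 1 + PowerSeries.X * (PowerSeries.C t * transferSeries q t 1) := by
  simpa using transferSeries_eq q t 0

lemma transferSeries_succ (g : ℕ) :
    (1 + PowerSeries.X * PowerSeries.C t - PowerSeries.X * PowerSeries.C (q ^ (g + 1))) *
        transferSeries q t (g + 1) =
      transferSeries q t g + PowerSeries.X * PowerSeries.C t * transferSeries q t (g + 2) := by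
  have h := transferSeries_eq q t (g + 1)
  have h' := transferSeries_eq q t g
  rw [Finset.sum_Icc_succ_top (by omega)] at h
  linear_combination h - h'

lemma constantCoeff_transferSeries (g : ℕ) :
    PowerSeries.constantCoeff (transferSeries q t g) = 1 := by
  simp [transferSeries]

end

/-- A solution of the three-term recurrence behind `transferSeries` is determined by its value
at `0`. -/
lemma eq_zero_of_three_term {R : Type*} [CommRing R] {b : R} {a : ℕ → R} {U : ℕ → PowerSeries R}
    (h0 : U 0 = 0)
    (hU : ∀ g, (1 + PowerSeries.X * PowerSeries.C (a g)) * U (g + 1) =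
      U g + PowerSeries.X * PowerSeries.C b * U (g + 2)) (g : ℕ) : U g = 0 := by
  ext n
  induction n generalizing g with
  | zero =>
    induction g with
    | zero => simp [h0]
    | succ g ih =>
      rw [PowerSeries.coeff_zero_eq_constantCoeff_apply] at ih ⊢
      simpa [ih] using congrArg PowerSeries.constantCoeff (hU g)
  | succ n ihn =>
    induction g with
    | zero => simp [h0]
    | succ g ih =>
      simpa [ih, ihn, mul_assoc, add_mul, PowerSeries.coeff_succ_X_mul]
        using congrArg (PowerSeries.coeff (n + 1)) (hU g)

lemma exists_transferSeries_ratio (t : Polynomial ℤ) :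
    ∃ L : PowerSeries (Polynomial ℤ), PowerSeries.constantCoeff L = 0 ∧
      L ^ 2 - (1 + (PowerSeries.C t ^ 2 - 1) * PowerSeries.X ^ 2) * L +
        PowerSeries.X ^ 2 * PowerSeries.C t ^ 2 = 0 ∧
      transferSeries (-1) t 0 * (1 + PowerSeries.X - L) =
        1 + PowerSeries.X + PowerSeries.X * PowerSeries.C t := by
  have h0 := transferSeries_zero (-1) t
  have hstep : ∀ g, (1 + PowerSeries.X * PowerSeries.C (t - (-1) ^ (g + 1))) *
      transferSeries (-1) t (g + 1) =
      transferSeries (-1) t g +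
        PowerSeries.X * PowerSeries.C t * transferSeries (-1) t (g + 2) := by
    intro g
    rw [← transferSeries_succ, map_sub]
    ring
  have hunit := PowerSeries.mul_invOfUnit (transferSeries (-1) t 0) 1
    (by simp [constantCoeff_transferSeries])
  generalize transferSeries (-1) t = T at *
  generalize (T 0).invOfUnit 1 = I at *
  obtain ⟨r, hr0⟩ : ∃ r, T 2 = r * T 0 := ⟨T 2 * I, by linear_combination (-T 2) * hunit⟩
  have hr1 : T 3 = r * T 1 := by
    refine sub_eq_zero.1 (eq_zero_of_three_term (b := t) (a := fun g => t - (-1) ^ (g + 1))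
      (U := fun g => T (g + 2) - r * T g) (sub_eq_zero.2 hr0) (fun g => ?_) 1)
    have h := hstep (g + 2)
    rw [show ((-1 : Polynomial ℤ)) ^ (g + 2 + 1) = (-1) ^ (g + 1) by ring] at h
    linear_combination h - r * hstep g
  have h1 : (1 + PowerSeries.X * PowerSeries.C t + PowerSeries.X) * T 1 =
      T 0 + PowerSeries.X * PowerSeries.C t * T 2 := by
    rw [← hstep 0]
    congr 1
    simp
    ring
  have h2 : (1 + PowerSeries.X * PowerSeries.C t - PowerSeries.X) * T 2 =
      T 1 + PowerSeries.X * PowerSeries.C t * T 3 := by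
    rw [← hstep 1]
    congr 1
    simp
    ring
  refine ⟨PowerSeries.X ^ 2 * PowerSeries.C t ^ 2 * r, by simp, ?_, ?_⟩
  all_goals
    generalize PowerSeries.C t = τ at *
    generalize (PowerSeries.X : PowerSeries (Polynomial ℤ)) = x at *
  · have hquad : T 0 * (((1 + x * τ) ^ 2 - x ^ 2) * r) = T 0 * (1 + x * τ * r) ^ 2 := by
      rw [hr1] at h2
      rw [hr0] at h1 h2
      linear_combination (1 + x * τ + x) * h2 + (1 + x * τ * r) * h1
    have hquad' : ((1 + x * τ) ^ 2 - x ^ 2) * r = (1 + x * τ * r) ^ 2 := by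
      linear_combination I * hquad +
        ((1 + x * τ * r) ^ 2 - ((1 + x * τ) ^ 2 - x ^ 2) * r) * hunit
    linear_combination (- x ^ 2 * τ ^ 2) * hquad'
  · linear_combination (1 + x + x * τ) * h0 + x * τ * h1 + x ^ 2 * τ ^ 2 * hr0

section
variable {R : Type*} [CommRing R] [IsDomain R]

lemma eq_of_quadratic {p d L M : PowerSeries R}
    (hL0 : PowerSeries.constantCoeff L = 0) (hM0 : PowerSeries.constantCoeff M = 0)
    (hp : PowerSeries.constantCoeff p = 1)
    (hL : L ^ 2 - p * L + d = 0) (hM : M ^ 2 - p * M + d = 0) : L = M := by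
  have hne : L + M - p ≠ 0 := fun h => by
    simpa [hL0, hM0, hp] using congrArg PowerSeries.constantCoeff h
  refine sub_eq_zero.1 ((mul_eq_zero.1 ?_).resolve_right hne)
  linear_combination hL - hM

lemma odd_part_equations {t x F F' L : PowerSeries R}
    (hx : PowerSeries.constantCoeff x = 0) (hL0 : PowerSeries.constantCoeff L = 0)
    (hL : L ^ 2 - (1 + (t ^ 2 - 1) * x ^ 2) * L + x ^ 2 * t ^ 2 = 0)
    (hF : F * (1 + x - L) = 1 + x + x * t) (hF' : F' * (1 - x - L) = 1 - x - x * t) :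
    F + F' = 2 + (t - 1) * (x * (F - F')) ∧
      (1 - (t - 1) ^ 2 * x ^ 2) * (2 * (x * (F - F')) - (x * (F - F')) ^ 2) = 4 * t * x ^ 2 := by
  have hne : (1 - L) ^ 2 - x ^ 2 ≠ 0 := fun h => by
    simpa [hx, hL0] using congrArg PowerSeries.constantCoeff h
  have h1 : (F + F') * (1 - L) + x * (F - F') = 2 := by linear_combination hF + hF'
  have h2 : x * (F - F') * (1 - L) + x ^ 2 * (F + F') = 2 * x ^ 2 * (1 + t) := by
    linear_combination x * hF - x * hF'
  generalize F + F' = A at *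
  generalize x * (F - F') = B at *
  have hA : A = 2 + (t - 1) * B := by
    refine sub_eq_zero.1 ((mul_eq_zero.1 ?_).resolve_right hne)
    linear_combination (1 - L) * h1 - h2 - (t - 1) * ((1 - L) * h2 - x ^ 2 * h1) - 2 * hL
  refine ⟨hA, ?_⟩
  subst hA
  linear_combination (2 + (t - 1) * B) * h2 - B * h1

lemma derivation_of_quadratic [CharZero R] {t x B : PowerSeries R}
    (D : Derivation R (PowerSeries R) (PowerSeries R)) (ht : D t = 0) (hDx : D x = 1)
    (hx : PowerSeries.constantCoeff x = 0) (hB0 : PowerSeries.constantCoeff B = 0)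
    (hB : (1 - (t - 1) ^ 2 * x ^ 2) * (2 * B - B ^ 2) = 4 * t * x ^ 2) :
    (1 - 2 * (1 + t ^ 2) * x ^ 2 + (1 - t ^ 2) ^ 2 * x ^ 4) * D B = 4 * t * x * (1 - B) := by
  have hne : 2 * (1 - B) * (1 - (t - 1) ^ 2 * x ^ 2) ≠ 0 := fun h => by
    simpa [hB0, hx, map_ofNat PowerSeries.constantCoeff 2] using
      congrArg PowerSeries.constantCoeff h
  have hH : (1 - B) ^ 2 * (1 - (t - 1) ^ 2 * x ^ 2) = 1 - (t + 1) ^ 2 * x ^ 2 := by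
    linear_combination -hB
  have hd : (1 - (t - 1) ^ 2 * x ^ 2) * (2 * (1 - B) * D B) -
      2 * (t - 1) ^ 2 * x * (2 * B - B ^ 2) = 8 * t * x := by
    have h2 : D (2 : PowerSeries R) = 0 := D.map_natCast 2
    have h4 : D (4 : PowerSeries R) = 0 := D.map_natCast 4
    have hd := congrArg D hB
    simp [Derivation.leibniz, Derivation.leibniz_pow, ht, hDx, h2, h4, smul_eq_mul] at hd
    linear_combination hd
  refine sub_eq_zero.1 ((mul_eq_zero.1 ?_).resolve_right hne)
  linear_combination (1 - (t - 1) ^ 2 * x ^ 2) * (1 - (t + 1) ^ 2 * x ^ 2) * hd -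
    (2 * (t - 1) ^ 2 * x * (1 - (t + 1) ^ 2 * x ^ 2) + 8 * t * x) * hH

end

/-- The generating series of the polynomials `ISign n`. -/
noncomputable def signSeries : PowerSeries (Polynomial ℤ) := PowerSeries.mk ISign

/-- The power series `∑ n, 2 * ISign (2 * n + 1) * x ^ (2 * n + 2)`. -/
noncomputable def oddSignSeries : PowerSeries (Polynomial ℤ) :=
  PowerSeries.X * (signSeries - PowerSeries.rescale (-1) signSeries)

lemma signSeries_eq : signSeries = transferSeries (-1) Polynomial.X 0 := by
  ext1 n
  rw [signSeries, transferSeries, PowerSeries.coeff_mk, PowerSeries.coeff_mk,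
    ISign_eq_iterate_transfer]

lemma rescale_C {R : Type*} [CommRing R] (a b : R) :
    PowerSeries.rescale a (PowerSeries.C b) = PowerSeries.C b := by
  ext n
  cases n <;> simp [PowerSeries.coeff_C]

lemma signSeries_equations :
    signSeries + PowerSeries.rescale (-1) signSeries =
        2 + (PowerSeries.C Polynomial.X - 1) * oddSignSeries ∧
      (1 - (PowerSeries.C Polynomial.X - 1) ^ 2 * PowerSeries.X ^ 2) *
        (2 * oddSignSeries - oddSignSeries ^ 2) =
          4 * PowerSeries.C Polynomial.X * PowerSeries.X ^ 2 := by
  obtain ⟨L, hL0, hL, hF⟩ := exists_transferSeries_ratio Polynomial.X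
  rw [← signSeries_eq] at hF
  have hX : PowerSeries.rescale (-1 : Polynomial ℤ) PowerSeries.X = -PowerSeries.X := by
    simp [PowerSeries.rescale_X]
  have hL' := congrArg (PowerSeries.rescale (-1)) hL
  have hF' := congrArg (PowerSeries.rescale (-1)) hF
  simp only [map_add, map_sub, map_mul, map_pow, map_one, map_zero, hX, rescale_C, neg_sq]
    at hL' hF'
  have heven : PowerSeries.rescale (-1) L = L :=
    eq_of_quadratic (by rw [← PowerSeries.coeff_zero_eq_constantCoeff_apply, PowerSeries.coeff_rescale,
      PowerSeries.coeff_zero_eq_constantCoeff_apply, hL0, mul_zero]) hL0 (by simp) hL' hL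
  rw [heven] at hF'
  exact odd_part_equations (by simp) hL0 hL hF (by linear_combination hF')

lemma coeff_oddSignSeries (n : ℕ) :
    PowerSeries.coeff (2 * n + 2) oddSignSeries = 2 * ISign (2 * n + 1) := by
  rw [oddSignSeries, PowerSeries.coeff_succ_X_mul, map_sub, PowerSeries.coeff_rescale, signSeries,
    PowerSeries.coeff_mk, Odd.neg_one_pow ⟨n, rfl⟩]
  ring

lemma ISign_even (n : ℕ) :
    ISign (2 * n + 2) = (Polynomial.X - 1) * ISign (2 * n + 1) := by
  have h := congrArg (PowerSeries.coeff (2 * n + 2)) signSeries_equations.1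
  rw [← map_one PowerSeries.C, ← map_sub, ← map_ofNat PowerSeries.C 2, map_add, map_add,
    PowerSeries.coeff_C_mul, coeff_oddSignSeries, PowerSeries.coeff_rescale, signSeries,
    PowerSeries.coeff_mk, PowerSeries.coeff_C, if_neg (by omega),
    Even.neg_one_pow ⟨n + 1, by ring⟩] at h
  refine mul_left_cancel₀ (two_ne_zero (α := Polynomial ℤ)) ?_
  linear_combination h

lemma oddSignSeries_derivative :
    PowerSeries.derivative (Polynomial ℤ) oddSignSeries +
        PowerSeries.C (-(2 * (1 + Polynomial.X ^ 2))) *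
          (PowerSeries.X ^ 2 * PowerSeries.derivative (Polynomial ℤ) oddSignSeries) +
        PowerSeries.C ((1 - Polynomial.X ^ 2) ^ 2) *
          (PowerSeries.X ^ 4 * PowerSeries.derivative (Polynomial ℤ) oddSignSeries) =
      PowerSeries.C (4 * Polynomial.X) * (PowerSeries.X * (1 - oddSignSeries)) := by
  have h := derivation_of_quadratic (PowerSeries.derivative (Polynomial ℤ)) (by simp) (by simp)
    (by simp) (by simp [oddSignSeries]) signSeries_equations.2
  simp only [map_neg, map_mul, map_add, map_sub, map_pow, map_one, map_ofNat]
  linear_combination h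

lemma ISign_odd (m : ℕ) :
    ((m : Polynomial ℤ) + 3) * ISign (2 * m + 5) =
      2 * ((1 + Polynomial.X ^ 2) * ((m : Polynomial ℤ) + 2) - Polynomial.X) * ISign (2 * m + 3) -
        (1 - Polynomial.X ^ 2) ^ 2 * ((m : Polynomial ℤ) + 1) * ISign (2 * m + 1) := by
  have h := congrArg (PowerSeries.coeff (2 * m + 1 + 4)) oddSignSeries_derivative
  have h1 := coeff_oddSignSeries m
  have h3 := coeff_oddSignSeries (m + 1)
  have h5 := coeff_oddSignSeries (m + 2)
  rw [map_add, map_add, PowerSeries.coeff_C_mul, PowerSeries.coeff_C_mul, PowerSeries.coeff_C_mul,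
    PowerSeries.coeff_X_pow_mul, show 2 * m + 1 + 4 = 2 * m + 3 + 2 by ring,
    PowerSeries.coeff_X_pow_mul, PowerSeries.coeff_succ_X_mul, map_sub, PowerSeries.coeff_one,
    if_neg (by omega), PowerSeries.coeff_derivative, PowerSeries.coeff_derivative,
    PowerSeries.coeff_derivative] at h
  simp only [mul_add, mul_one, Nat.reduceMul, add_assoc, Nat.reduceAdd] at h h1 h3 h5
  rw [h1, h3, h5] at h
  push_cast at h
  refine mul_left_cancel₀ (OfNat.ofNat_ne_zero 4 : (4 : Polynomial ℤ) ≠ 0) ?_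
  linear_combination h

/-- recursions for `I_m(-1,t)`: for n ≥ 1,
`I_{2n}(-1,t) = (t-1)·I_{2n-1}(-1,t)`, and for n ≥ 2,
`(n+1)·I_{2n+1}(-1,t) = 2((1+t²)n - t)·I_{2n-1}(-1,t) - (1-t²)²(n-1)·I_{2n-3}(-1,t)`. -/
theorem stmt19 :
    (∀ n : ℕ, 1 ≤ n → ISign (2 * n) = (Polynomial.X - 1) * ISign (2 * n - 1)) ∧
      (∀ n : ℕ, 2 ≤ n →
        ((n : Polynomial ℤ) + 1) * ISign (2 * n + 1) =
          2 * ((1 + Polynomial.X ^ 2) * (n : Polynomial ℤ) - Polynomial.X) * ISign (2 * n - 1) -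
            (1 - Polynomial.X ^ 2) ^ 2 * ((n : Polynomial ℤ) - 1) * ISign (2 * n - 3)) := by
  refine ⟨fun n hn => ?_, fun n hn => ?_⟩
  · obtain ⟨m, rfl⟩ := Nat.exists_eq_add_of_le' hn
    exact ISign_even m
  · obtain ⟨m, rfl⟩ := Nat.exists_eq_add_of_le' hn
    have h := ISign_odd m
    rw [show 2 * (m + 2) + 1 = 2 * m + 5 by ring, show 2 * (m + 2) - 1 = 2 * m + 3 by omega,
      show 2 * (m + 2) - 3 = 2 * m + 1 by omega]
    push_cast
    linear_combination h
end
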